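/- arXiv:2108.09244 — 3 statements merged into one kernel-verified Lean document; each statement's English description precedes it below -/
import Mathlib

section
/- Let a > 0 and c' < c < 1. Then the function z ↦ Ψ(a,c,z)/Ψ(a,c',z) is completely monotone on (0,∞). -/
open MeasureTheory Set

/-- The confluent hypergeometric function of the second kind (Tricomi's integral). -/
noncomputable def Psi (a c z : ℝ) : ℝ :=
  (1 / Real.Gamma a) * ∫ t in Ioi (0 : ℝ), Real.exp (-z * t) * t ^ (a - 1) * (1 + t) ^ (c - a - 1)

open Filter Topology

/-! ### Complete monotonicity through alternating differences -/

/-- The backward-signed difference `x ↦ f x - f (x + h)`. -/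
def altDiff (h : ℝ) (f : ℝ → ℝ) : ℝ → ℝ := fun x => f x - f (x + h)

/-- Iterated alternating differences along a list of steps. -/
def altDiffs : List ℝ → (ℝ → ℝ) → ℝ → ℝ
  | [], f => f
  | h :: l, f => altDiffs l (altDiff h f)

/-- Complete monotonicity on `(0,∞)` expressed by differences: all alternating differences with
positive steps are nonnegative. -/
def DiffCM (f : ℝ → ℝ) : Prop :=
  ∀ l : List ℝ, (∀ h ∈ l, 0 < h) → ∀ x, 0 < x → 0 ≤ altDiffs l f x

theorem altDiffs_add (l : List ℝ) (f g : ℝ → ℝ) :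
    altDiffs l (fun x => f x + g x) = fun x => altDiffs l f x + altDiffs l g x := by
  induction l generalizing f g with
  | nil => rfl
  | cons h l ih =>
    simp only [altDiffs]
    rw [← ih]
    congr 1
    funext x
    simp only [altDiff]
    ring

theorem altDiffs_const_mul (l : List ℝ) (k : ℝ) (f : ℝ → ℝ) :
    altDiffs l (fun x => k * f x) = fun x => k * altDiffs l f x := by
  induction l generalizing f with
  | nil => rfl
  | cons h l ih =>
    simp only [altDiffs]
    rw [← ih]
    congr 1
    funext x
    simp only [altDiff]
    ring

theorem altDiffs_comp_add (l : List ℝ) (k : ℝ) (f : ℝ → ℝ) (x : ℝ) :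
    altDiffs l (fun x => f (x + k)) x = altDiffs l f (x + k) := by
  induction l generalizing f with
  | nil => rfl
  | cons h l ih =>
    simp only [altDiffs]
    rw [← ih]
    congr 1
    funext x
    simp only [altDiff]
    ring_nf

theorem altDiffs_comp_mul (l : List ℝ) (k : ℝ) (f : ℝ → ℝ) (x : ℝ) :
    altDiffs l (fun x => f (x * k)) x = altDiffs (l.map (· * k)) f (x * k) := by
  induction l generalizing f with
  | nil => rfl
  | cons h l ih =>
    simp only [altDiffs, List.map_cons]
    rw [← ih]
    congr 1
    funext x
    simp only [altDiff]
    ring_nf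

theorem altDiffs_congr {f g : ℝ → ℝ} (hfg : ∀ x, 0 < x → f x = g x) (l : List ℝ)
    (hl : ∀ h ∈ l, 0 < h) (x : ℝ) (hx : 0 < x) : altDiffs l f x = altDiffs l g x := by
  induction l generalizing f g with
  | nil => exact hfg x hx
  | cons h l ih =>
    have hh : 0 < h := hl h (by simp)
    refine ih (fun y hy => ?_) fun k hk => hl k (by simp [hk])
    simp only [altDiff, hfg y hy, hfg (y + h) (by positivity)]

theorem tendsto_altDiffs {ι : Type*} {F : Filter ι} {f : ι → ℝ → ℝ} {g : ℝ → ℝ}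
    (hfg : ∀ x, 0 < x → Tendsto (fun i => f i x) F (𝓝 (g x))) (l : List ℝ)
    (hl : ∀ h ∈ l, 0 < h) (x : ℝ) (hx : 0 < x) :
    Tendsto (fun i => altDiffs l (f i) x) F (𝓝 (altDiffs l g x)) := by
  induction l generalizing f g with
  | nil => exact hfg x hx
  | cons h l ih =>
    have hh : 0 < h := hl h (by simp)
    exact ih (f := fun i => altDiff h (f i))
      (fun y hy => (hfg y hy).sub (hfg (y + h) (by positivity))) fun k hk => hl k (by simp [hk])

theorem altDiffs_setIntegral {s : Set ℝ} {Φ : ℝ → ℝ → ℝ}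
    (hΦ : ∀ x, 0 < x → IntegrableOn (fun r => Φ r x) s) (l : List ℝ) (hl : ∀ h ∈ l, 0 < h)
    (x : ℝ) (hx : 0 < x) :
    altDiffs l (fun x => ∫ r in s, Φ r x) x = ∫ r in s, altDiffs l (Φ r) x := by
  induction l generalizing Φ with
  | nil => rfl
  | cons h l ih =>
    have hh : 0 < h := hl h (by simp)
    have hl' : ∀ k ∈ l, 0 < k := fun k hk => hl k (by simp [hk])
    simp only [altDiffs]
    rw [← ih (Φ := fun r => altDiff h (Φ r))
      (fun y hy => (hΦ y hy).sub (hΦ (y + h) (by positivity))) hl']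
    refine altDiffs_congr (fun y hy => ?_) l hl' x hx
    exact (integral_sub (hΦ y hy) (hΦ (y + h) (by positivity))).symm

namespace DiffCM

variable {f g : ℝ → ℝ}

theorem nonneg (hf : DiffCM f) {x : ℝ} (hx : 0 < x) : 0 ≤ f x :=
  hf [] (by simp) x hx

theorem altDiff (hf : DiffCM f) {h : ℝ} (hh : 0 < h) : DiffCM (altDiff h f) :=
  fun l hl => hf (h :: l) (by simpa [hh] using hl)

theorem antitoneOn (hf : DiffCM f) : AntitoneOn f (Ioi 0) := by
  intro x hx y _ hxy
  rcases hxy.eq_or_lt with rfl | hxy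
  · exact le_rfl
  · have := (hf.altDiff (sub_pos.2 hxy)).nonneg hx
    simp only [_root_.altDiff, add_sub_cancel] at this
    linarith

theorem comp_add (hf : DiffCM f) {k : ℝ} (hk : 0 < k) : DiffCM fun x => f (x + k) :=
  fun l hl x hx => by
    rw [altDiffs_comp_add]
    exact hf l hl _ (by positivity)

theorem comp_mul (hf : DiffCM f) {k : ℝ} (hk : 0 < k) : DiffCM fun x => f (x * k) :=
  fun l hl x hx => by
    rw [altDiffs_comp_mul]
    refine hf _ (fun h hh => ?_) _ (by positivity)
    obtain ⟨j, hj, rfl⟩ := List.mem_map.1 hh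
    exact mul_pos (hl j hj) hk

theorem congr (hf : DiffCM f) (hfg : ∀ x, 0 < x → g x = f x) : DiffCM g :=
  fun l hl x hx => by
    rw [altDiffs_congr hfg l hl x hx]
    exact hf l hl x hx

theorem add (hf : DiffCM f) (hg : DiffCM g) : DiffCM fun x => f x + g x :=
  fun l hl x hx => by
    rw [altDiffs_add]
    exact add_nonneg (hf l hl x hx) (hg l hl x hx)

theorem const_mul (hf : DiffCM f) {k : ℝ} (hk : 0 ≤ k) : DiffCM fun x => k * f x :=
  fun l hl x hx => by
    rw [altDiffs_const_mul]
    exact mul_nonneg hk (hf l hl x hx)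

theorem mul (hf : DiffCM f) (hg : DiffCM g) : DiffCM fun x => f x * g x := by
  intro l
  induction l generalizing f g with
  | nil => exact fun _ x hx => mul_nonneg (hf.nonneg hx) (hg.nonneg hx)
  | cons h l ih =>
    intro hl x hx
    have hh : 0 < h := hl h (by simp)
    have hl' : ∀ k ∈ l, 0 < k := fun k hk => hl k (by simp [hk])
    have key : _root_.altDiff h (fun x => f x * g x) =
        fun x => _root_.altDiff h f x * g x + f (x + h) * _root_.altDiff h g x := by
      funext y
      simp only [_root_.altDiff]
      ring
    simp only [altDiffs]
    rw [key, altDiffs_add]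
    exact add_nonneg (ih (hf.altDiff hh) hg hl' x hx)
      (ih (hf.comp_add hh) (hg.altDiff hh) hl' x hx)

theorem exp_neg_mul {r : ℝ} (hr : 0 ≤ r) : DiffCM fun x => Real.exp (-x * r) := by
  intro l
  induction l with
  | nil => exact fun _ x _ => (Real.exp_pos _).le
  | cons h l ih =>
    intro hl x hx
    have hh : 0 < h := hl h (by simp)
    have key : _root_.altDiff h (fun x => Real.exp (-x * r)) =
        fun x => (1 - Real.exp (-h * r)) * Real.exp (-x * r) := by
      funext y
      simp only [_root_.altDiff]
      rw [show -(y + h) * r = -h * r + -y * r by ring, Real.exp_add]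
      ring
    simp only [altDiffs]
    rw [key, altDiffs_const_mul]
    refine mul_nonneg (sub_nonneg.2 (Real.exp_le_one_iff.2 ?_))
      (ih (fun k hk => hl k (by simp [hk])) x hx)
    nlinarith

theorem const {k : ℝ} (hk : 0 ≤ k) : DiffCM fun _ => k :=
  ((exp_neg_mul le_rfl).const_mul hk).congr fun x _ => by simp

theorem of_tendsto {ι : Type*} {F : Filter ι} [F.NeBot] {u : ι → ℝ → ℝ}
    (hu : ∀ᶠ i in F, DiffCM (u i))
    (huf : ∀ x, 0 < x → Tendsto (fun i => u i x) F (𝓝 (f x))) : DiffCM f :=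
  fun l hl x hx => ge_of_tendsto (tendsto_altDiffs huf l hl x hx)
    (hu.mono fun _ hi => hi l hl x hx)

theorem setIntegral {Φ : ℝ → ℝ → ℝ} {s : Set ℝ} (hs : MeasurableSet s)
    (hΦ : ∀ r ∈ s, DiffCM (Φ r)) (hΦint : ∀ x, 0 < x → IntegrableOn (fun r => Φ r x) s) :
    DiffCM fun x => ∫ r in s, Φ r x :=
  fun l hl x hx => by
    rw [altDiffs_setIntegral hΦint l hl x hx]
    exact setIntegral_nonneg hs fun r hr => hΦ r hr l hl x hx

theorem neg_deriv (hf : DiffCM f) (hd : ∀ x, 0 < x → DifferentiableAt ℝ f x) :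
    DiffCM fun x => -deriv f x := by
  refine of_tendsto (F := 𝓝[>] 0) (u := fun δ x => δ⁻¹ * _root_.altDiff δ f x) ?_ ?_
  · filter_upwards [self_mem_nhdsWithin] with δ hδ
    exact (hf.altDiff hδ).const_mul (inv_nonneg.2 (le_of_lt hδ))
  · intro x hx
    have := (hd x hx).hasDerivAt.tendsto_slope_zero_right.neg
    refine this.congr fun δ => ?_
    simp only [_root_.altDiff, smul_eq_mul]
    ring

theorem iteratedDeriv_nonneg (hf : DiffCM f) (ha : AnalyticOnNhd ℝ f (Ioi 0)) (n : ℕ) {x : ℝ}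
    (hx : 0 < x) : 0 ≤ (-1) ^ n * iteratedDeriv n f x := by
  induction n generalizing f with
  | zero => simpa using hf.nonneg hx
  | succ n ih =>
    have h := ih (hf.neg_deriv fun y hy => (ha y hy).differentiableAt) ha.deriv.neg
    rw [iteratedDeriv_fun_neg] at h
    rw [iteratedDeriv_succ', pow_succ]
    linarith

end DiffCM

/-- If `-R' = U R` with `U` completely monotone and `R` nonnegative, then `R` is completely
monotone. -/
theorem iteratedDeriv_nonneg_of_deriv_eq_neg_mul {U R : ℝ → ℝ} (hU : DiffCM U)
    (hUa : AnalyticOnNhd ℝ U (Ioi 0)) (hRa : AnalyticOnNhd ℝ R (Ioi 0))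
    (hR : ∀ x, 0 < x → 0 ≤ R x) (hUR : ∀ x, 0 < x → deriv R x = -(U x * R x)) (n : ℕ) {x : ℝ}
    (hx : 0 < x) : 0 ≤ (-1) ^ n * iteratedDeriv n R x := by
  induction n using Nat.strong_induction_on with
  | _ n ih =>
    cases n with
    | zero => simpa using hR x hx
    | succ n =>
      have heq : deriv R =ᶠ[𝓝 x] fun x => -((U * R) x) := by
        filter_upwards [Ioi_mem_nhds hx] with y hy using hUR y hy
      rw [iteratedDeriv_succ', heq.iteratedDeriv_eq, iteratedDeriv_fun_neg,
        iteratedDeriv_mul (hUa x hx).contDiffAt (hRa x hx).contDiffAt, pow_succ, mul_neg_one,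
        neg_mul_neg, Finset.mul_sum]
      refine Finset.sum_nonneg fun i hi => ?_
      have hin : i ≤ n := by simpa [Nat.lt_succ_iff] using hi
      have h1 := hU.iteratedDeriv_nonneg hUa i hx
      have h2 := ih (n - i) (by omega)
      have h3 : (-1 : ℝ) ^ n = (-1) ^ i * (-1) ^ (n - i) := by
        rw [← pow_add, Nat.add_sub_cancel' hin]
      rw [h3]
      have := mul_nonneg (Nat.cast_nonneg (α := ℝ) (n.choose i)) (mul_nonneg h1 h2)
      linarith

/-! ### An integral operator preserving complete monotonicity -/

/-- The integral operator inverting `y ↦ (z + β) y - z y'` on functions tame at infinity. -/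
noncomputable def tailOp (β : ℝ) (q : ℝ → ℝ) (z : ℝ) : ℝ :=
  ∫ r in Ioi (0 : ℝ), Real.exp (-z * r) * (1 + r) ^ (-β - 1) * q (z * (1 + r))

/-- The integrals defining `tailOp β q` on `(0,∞)` converge. -/
def TailIntegrable (β : ℝ) (q : ℝ → ℝ) : Prop :=
  ∀ z, 0 < z →
    IntegrableOn (fun r => Real.exp (-z * r) * (1 + r) ^ (-β - 1) * q (z * (1 + r))) (Ioi 0)

theorem integral_Ioi_exp_neg_mul {z : ℝ} (hz : 0 < z) :
    ∫ r in Ioi (0 : ℝ), Real.exp (-z * r) = 1 / z := by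
  rw [integral_exp_mul_Ioi (by linarith)]
  simp

theorem continuousOn_one_add_rpow (s : ℝ) : ContinuousOn (fun r : ℝ => (1 + r) ^ s) (Ioi 0) :=
  fun r hr => (ContinuousAt.rpow_const (by fun_prop)
    (Or.inl (by have : 0 < r := hr; positivity))).continuousWithinAt

theorem hasDerivAt_one_add_rpow (s : ℝ) {r : ℝ} (hr : 0 ≤ r) :
    HasDerivAt (fun r : ℝ => (1 + r) ^ s) (s * (1 + r) ^ (s - 1)) r := by
  have := ((hasDerivAt_id r).const_add 1).rpow_const (p := s) (Or.inl (by simp; positivity))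
  simpa using this

theorem tendsto_one_add_rpow_neg {s : ℝ} (hs : 0 < s) :
    Tendsto (fun r : ℝ => (1 + r) ^ (-s)) atTop (𝓝 0) :=
  (tendsto_rpow_neg_atTop hs).comp (tendsto_atTop_add_const_left _ _ tendsto_id)

theorem one_add_rpow_integral {s : ℝ} (hs : 0 < s) :
    IntegrableOn (fun r : ℝ => (1 + r) ^ (-s - 1)) (Ioi 0) ∧
      ∫ r in Ioi (0 : ℝ), (1 + r) ^ (-s - 1) = 1 / s := by
  have hd : ∀ r ∈ Ici (0 : ℝ),
      HasDerivAt (fun r : ℝ => -(1 / s) * (1 + r) ^ (-s)) ((1 + r) ^ (-s - 1)) r := fun r hr => by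
    have := (hasDerivAt_one_add_rpow (-s) (r := r) hr).const_mul (-(1 / s))
    convert! this using 1
    field_simp
  have hpos : ∀ r ∈ Ioi (0 : ℝ), 0 ≤ (1 + r) ^ (-s - 1) := fun r hr => by
    have : 0 < r := hr
    positivity
  have hlim := (tendsto_one_add_rpow_neg hs).const_mul (-(1 / s))
  refine ⟨integrableOn_Ioi_deriv_of_nonneg' hd hpos hlim, ?_⟩
  rw [integral_Ioi_of_hasDerivAt_of_nonneg' hd hpos hlim]
  simp

theorem abs_tailKernel_le {β z r x K : ℝ} (hβ : -1 ≤ β) (hr : 0 < r) (hx : |x| ≤ K) :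
    |Real.exp (-z * r) * (1 + r) ^ (-β - 1) * x| ≤ K * Real.exp (-z * r) := by
  have h1 : (1 + r) ^ (-β - 1) ≤ 1 :=
    Real.rpow_le_one_of_one_le_of_nonpos (by linarith) (by linarith)
  have h2 : 0 ≤ (1 + r) ^ (-β - 1) := by positivity
  have h3 := Real.exp_pos (-z * r)
  rw [abs_mul, abs_of_nonneg (by positivity)]
  calc Real.exp (-z * r) * (1 + r) ^ (-β - 1) * |x|
      ≤ Real.exp (-z * r) * 1 * K := by gcongr
    _ = _ := by ring

theorem integrableOn_tailKernel {β z K : ℝ} {q : ℝ → ℝ} (hβ : -1 ≤ β) (hz : 0 < z)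
    (hm : AEStronglyMeasurable (fun r => q (z * (1 + r))) (volume.restrict (Ioi 0)))
    (hK : ∀ w, z ≤ w → |q w| ≤ K) :
    IntegrableOn (fun r => Real.exp (-z * r) * (1 + r) ^ (-β - 1) * q (z * (1 + r))) (Ioi 0) := by
  refine Integrable.mono' ((integrableOn_exp_mul_Ioi (a := -z) (by linarith) 0).const_mul K) ?_ ?_
  · refine (AEStronglyMeasurable.mul (by fun_prop) ?_).mul hm
    exact (continuousOn_one_add_rpow _).aestronglyMeasurable measurableSet_Ioi
  · filter_upwards [ae_restrict_mem measurableSet_Ioi] with r hr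
    have hr : 0 < r := hr
    exact abs_tailKernel_le hβ hr (hK _ (by nlinarith))

theorem tailIntegrable_of_continuousOn {β : ℝ} {q : ℝ → ℝ} (hβ : -1 ≤ β)
    (hq : ContinuousOn q (Ioi 0)) (hK : ∀ z, 0 < z → ∃ K, ∀ w, z ≤ w → |q w| ≤ K) :
    TailIntegrable β q := by
  intro z hz
  obtain ⟨K, hK⟩ := hK z hz
  refine integrableOn_tailKernel hβ hz ?_ hK
  refine ContinuousOn.aestronglyMeasurable ?_ measurableSet_Ioi
  refine hq.comp (by fun_prop) fun r hr => ?_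
  have : 0 < r := hr
  simp only [mem_Ioi]
  positivity

theorem DiffCM.tailIntegrable {β : ℝ} {q : ℝ → ℝ} (hβ : -1 ≤ β) (hq : DiffCM q) :
    TailIntegrable β q := by
  intro z hz
  refine integrableOn_tailKernel (K := q z) hβ hz ?_ fun w hw => ?_
  · refine (aemeasurable_restrict_of_antitoneOn measurableSet_Ioi ?_).aestronglyMeasurable
    intro r hr s hs hrs
    have hr : 0 < r := hr
    have hs : 0 < s := hs
    exact hq.antitoneOn (by simp only [mem_Ioi]; positivity) (by simp only [mem_Ioi]; positivity)
      (by gcongr)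
  · have hw0 : 0 < w := hz.trans_le hw
    rw [abs_of_nonneg (hq.nonneg hw0)]
    exact hq.antitoneOn hz hw0 hw

theorem DiffCM.tailOp {β : ℝ} {q : ℝ → ℝ} (hβ : -1 ≤ β) (hq : DiffCM q) :
    DiffCM (tailOp β q) := by
  refine DiffCM.setIntegral measurableSet_Ioi (fun r hr => ?_) (hq.tailIntegrable hβ)
  have hr : 0 < r := hr
  exact ((DiffCM.exp_neg_mul hr.le).mul (DiffCM.const (by positivity))).mul
    (hq.comp_mul (by positivity))

theorem abs_tailOp_sub_le {β B z : ℝ} {q₁ q₂ g : ℝ → ℝ} (h₁ : TailIntegrable β q₁)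
    (h₂ : TailIntegrable β q₂) (hz : 0 < z) (hg : IntegrableOn g (Ioi 0))
    (hle : ∀ r, 0 < r → Real.exp (-z * r) * (1 + r) ^ (-β - 1) *
      |q₁ (z * (1 + r)) - q₂ (z * (1 + r))| ≤ B * g r) :
    |tailOp β q₁ z - tailOp β q₂ z| ≤ B * ∫ r in Ioi 0, g r := by
  unfold tailOp
  rw [← integral_sub (h₁ z hz) (h₂ z hz), ← integral_const_mul, ← Real.norm_eq_abs]
  refine norm_integral_le_of_norm_le (hg.const_mul B) ?_
  filter_upwards [ae_restrict_mem measurableSet_Ioi] with r hr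
  have hr : 0 < r := hr
  rw [← mul_sub, Real.norm_eq_abs, abs_mul, abs_of_nonneg (by positivity)]
  exact hle r hr

theorem abs_tailOp_sub_le_div_pow_succ {β B z : ℝ} {q₁ q₂ : ℝ → ℝ} {k : ℕ} (hβ : -1 ≤ β)
    (h₁ : TailIntegrable β q₁) (h₂ : TailIntegrable β q₂) (hz : 0 < z)
    (hB : ∀ w, 0 < w → |q₁ w - q₂ w| ≤ B / w ^ k) :
    |tailOp β q₁ z - tailOp β q₂ z| ≤ B / z ^ (k + 1) := by
  have hB0 : 0 ≤ B := by simpa using (abs_nonneg _).trans (hB 1 one_pos)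
  have := abs_tailOp_sub_le (B := B / z ^ k) h₁ h₂ hz
    (integrableOn_exp_mul_Ioi (a := -z) (by linarith) 0) fun r hr => by
      have h : |q₁ (z * (1 + r)) - q₂ (z * (1 + r))| ≤ B / z ^ k :=
        (hB _ (by positivity)).trans (by gcongr; nlinarith)
      have := abs_tailKernel_le (z := z) (K := B / z ^ k) (x := |q₁ (z * (1 + r)) - q₂ (z * (1 + r))|) hβ hr
        (by rwa [abs_abs])
      exact (le_abs_self _).trans this
  rw [integral_Ioi_exp_neg_mul hz] at this
  refine this.trans_eq ?_
  rw [pow_succ]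
  field_simp

theorem abs_tailOp_sub_le_div_pow {β B z : ℝ} {q₁ q₂ : ℝ → ℝ} {k : ℕ}
    (h₁ : TailIntegrable β q₁) (h₂ : TailIntegrable β q₂) (hk : 0 < β + k) (hz : 0 < z)
    (hB : ∀ w, 0 < w → |q₁ w - q₂ w| ≤ B / w ^ k) :
    |tailOp β q₁ z - tailOp β q₂ z| ≤ B / (β + k) / z ^ k := by
  have hB0 : 0 ≤ B := by simpa using (abs_nonneg _).trans (hB 1 one_pos)
  have := abs_tailOp_sub_le (B := B / z ^ k) h₁ h₂ hz (one_add_rpow_integral hk).1 fun r hr => by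
    calc Real.exp (-z * r) * (1 + r) ^ (-β - 1) * |q₁ (z * (1 + r)) - q₂ (z * (1 + r))|
        ≤ 1 * (1 + r) ^ (-β - 1) * (B / (z * (1 + r)) ^ k) := by
          gcongr
          · exact Real.exp_le_one_iff.2 (by nlinarith)
          · exact hB _ (by positivity)
      _ = B / z ^ k * (1 + r) ^ (-(β + k) - 1) := by
          rw [show -(β + k) - 1 = (-β - 1) - (k : ℝ) by ring,
            Real.rpow_sub_natCast (by positivity), mul_pow]
          field_simp
  rw [(one_add_rpow_integral hk).2] at this
  refine this.trans_eq ?_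
  field_simp

/-- A solution of `z y' = (z + β) y - q` that is bounded at infinity equals `tailOp β q`. -/
theorem eq_tailOp {β : ℝ} {y q : ℝ → ℝ} (hβ : -1 ≤ β)
    (hy : ∀ z, 0 < z → ∃ d, HasDerivAt y d z ∧ z * d = (z + β) * y z - q z)
    (hyK : ∀ z, 0 < z → ∃ K, ∀ w, z ≤ w → |y w| ≤ K) (hq : TailIntegrable β q) {z : ℝ}
    (hz : 0 < z) : y z = tailOp β q z := by
  have hd : ∀ r ∈ Ici (0 : ℝ),
      HasDerivAt (fun r => Real.exp (-z * r) * (1 + r) ^ (-β) * y (z * (1 + r)))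
        (-(Real.exp (-z * r) * (1 + r) ^ (-β - 1) * q (z * (1 + r)))) r := by
    intro r hr
    have hr : 0 ≤ r := hr
    obtain ⟨d, hd, hdq⟩ := hy (z * (1 + r)) (by positivity)
    have he : HasDerivAt (fun r => Real.exp (-z * r)) (Real.exp (-z * r) * (-z)) r := by
      simpa using ((hasDerivAt_id r).const_mul (-z)).exp
    have hl : HasDerivAt (fun r => z * (1 + r)) z r := by
      simpa using ((hasDerivAt_id r).const_add 1).const_mul z
    have hc : HasDerivAt (fun r => y (z * (1 + r))) (d * z) r := HasDerivAt.comp r hd hl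
    convert! (he.mul (hasDerivAt_one_add_rpow (-β) hr)).mul hc using 1
    rw [Real.rpow_sub_one (by positivity)]
    have h1 : q (z * (1 + r)) =
      (z * (1 + r) + β) * y (z * (1 + r)) - z * (1 + r) * d := by linarith
    rw [h1]
    simp only [Pi.mul_apply]
    field_simp
    ring
  have hlim : Tendsto (fun r => Real.exp (-z * r) * (1 + r) ^ (-β) * y (z * (1 + r)))
      atTop (𝓝 0) := by
    obtain ⟨K, hK⟩ := hyK z hz
    have hexp : Tendsto (fun r : ℝ => (Real.exp (-z * r) * 1 + r ^ (1 : ℝ) * Real.exp (-z * r)) * K)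
        atTop (𝓝 0) := by
      have h1 : Tendsto (fun r : ℝ => Real.exp (-z * r)) atTop (𝓝 0) :=
        Real.tendsto_exp_atBot.comp (tendsto_id.const_mul_atTop_of_neg (by linarith))
      have h2 := tendsto_rpow_mul_exp_neg_mul_atTop_nhds_zero 1 z hz
      simpa using ((h1.mul_const 1).add h2).mul_const K
    refine squeeze_zero_norm' ?_ hexp
    filter_upwards [eventually_gt_atTop 0] with r hr
    have hb := hK (z * (1 + r)) (by nlinarith)
    have hp : (1 + r) ^ (-β) ≤ 1 + r := by
      calc (1 + r) ^ (-β) ≤ (1 + r) ^ (1 : ℝ) :=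
            Real.rpow_le_rpow_of_exponent_le (by linarith) (by linarith)
        _ = 1 + r := Real.rpow_one _
    rw [Real.norm_eq_abs, abs_mul, abs_of_nonneg (by positivity), Real.rpow_one]
    calc Real.exp (-z * r) * (1 + r) ^ (-β) * |y (z * (1 + r))|
        ≤ Real.exp (-z * r) * (1 + r) * K := by gcongr
      _ = _ := by ring
  have := integral_Ioi_of_hasDerivAt_of_tendsto' hd (hq z hz).neg hlim
  rw [integral_neg] at this
  simp only [mul_zero, Real.exp_zero, add_zero, Real.one_rpow, mul_one, one_mul, zero_sub,
    neg_inj] at this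
  exact this.symm

/-- A fixed point of `y ↦ tailOp β (Q y)` is completely monotone as soon as `Q` preserves complete
monotonicity and is Lipschitz, both on a class of functions stable under the iteration. -/
theorem DiffCM.of_fixedPoint {β C M : ℝ} {p : ℕ} {y : ℝ → ℝ} {Q : (ℝ → ℝ) → ℝ → ℝ}
    (I : (ℝ → ℝ) → Prop) (hβ : -1 ≤ β) (hC : 0 ≤ C) (hI0 : I 0)
    (hI : ∀ f, DiffCM f → I f → I (_root_.tailOp β (Q f)))
    (hQ : ∀ f, DiffCM f → DiffCM (Q f)) (hQy : TailIntegrable β (Q y))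
    (hLip : ∀ f, DiffCM f → I f → ∀ w, 0 < w → |Q y w - Q f w| ≤ C * |y w - f w|)
    (hy : ∀ z, 0 < z → y z = _root_.tailOp β (Q y) z) (hM : ∀ z, 0 < z → |y z| ≤ M / z ^ p) :
    DiffCM y := by
  set u : ℕ → ℝ → ℝ := fun n => (fun f => _root_.tailOp β (Q f))^[n] 0 with hu
  have hsucc : ∀ n, u (n + 1) = _root_.tailOp β (Q (u n)) := fun n =>
    Function.iterate_succ_apply' (fun f => _root_.tailOp β (Q f)) n 0
  have hcm : ∀ n, DiffCM (u n) ∧ I (u n) := by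
    intro n
    induction n with
    | zero => exact ⟨DiffCM.const le_rfl, hI0⟩
    | succ n ih =>
      rw [hsucc]
      exact ⟨(hQ _ ih.1).tailOp hβ, hI _ ih.1 ih.2⟩
  have hstep : ∀ n B (k : ℕ), (∀ w, 0 < w → |y w - u n w| ≤ B / w ^ k) →
      ∀ w, 0 < w → |Q y w - Q (u n) w| ≤ C * B / w ^ k := fun n B k hB w hw => by
    refine (hLip _ (hcm n).1 (hcm n).2 w hw).trans ?_
    rw [mul_div_assoc]
    exact mul_le_mul_of_nonneg_left (hB w hw) hC
  have hfirst : ∀ n z, 0 < z → |y z - u n z| ≤ C ^ n * M / z ^ (p + n) := by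
    intro n
    induction n with
    | zero => simpa [hu] using hM
    | succ n ih =>
      intro z hz
      rw [hsucc, hy z hz]
      refine (abs_tailOp_sub_le_div_pow_succ hβ hQy ((hQ _ (hcm n).1).tailIntegrable hβ) hz
        (hstep n _ _ ih)).trans_eq ?_
      ring
  obtain ⟨N, hN⟩ := exists_nat_ge (2 * C + 1 - β)
  have hpN : 2 * C + 1 ≤ β + ((p + N : ℕ) : ℝ) := by
    push_cast
    have : (0 : ℝ) ≤ p := p.cast_nonneg
    linarith
  have hsecond : ∀ m z, 0 < z →
      |y z - u (N + m) z| ≤ (1 / 2) ^ m * (C ^ N * M) / z ^ (p + N) := by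
    intro m
    induction m with
    | zero => simpa using hfirst N
    | succ m ih =>
      intro z hz
      have hB0 : 0 ≤ (1 / 2) ^ m * (C ^ N * M) := by
        simpa using (abs_nonneg _).trans (ih 1 one_pos)
      rw [← add_assoc, hsucc, hy z hz]
      refine (abs_tailOp_sub_le_div_pow hQy ((hQ _ (hcm _).1).tailIntegrable hβ) (by linarith) hz
        (hstep _ _ _ ih)).trans ?_
      gcongr
      rw [div_le_iff₀ (by linarith), pow_succ]
      nlinarith
  refine DiffCM.of_tendsto (F := atTop) (u := fun m => u (N + m))
    (Eventually.of_forall fun m => (hcm _).1) fun z hz => ?_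
  rw [tendsto_iff_norm_sub_tendsto_zero]
  have hlim : Tendsto (fun m : ℕ => (1 / 2 : ℝ) ^ m * (C ^ N * M) / z ^ (p + N)) atTop (𝓝 0) := by
    simpa using ((tendsto_pow_atTop_nhds_zero_of_lt_one (r := (1 / 2 : ℝ)) (by norm_num)
      (by norm_num)).mul_const (C ^ N * M)).div_const (z ^ (p + N))
  refine squeeze_zero (fun _ => norm_nonneg _) (fun m => ?_) hlim
  rw [Real.norm_eq_abs, abs_sub_comm]
  exact hsecond m z hz

/-! ### Tricomi's integrals and their logarithmic derivative -/

/-- The Laplace transform of `t ^ p * (1 + t) ^ q`. -/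
noncomputable def tricomiIntegral (p q z : ℝ) : ℝ :=
  ∫ t in Ioi (0 : ℝ), Real.exp (-z * t) * t ^ p * (1 + t) ^ q

section TricomiIntegral

variable {p q z : ℝ}

theorem integrableOn_tricomi (hp : -1 < p) (q : ℝ) (hz : 0 < z) :
    IntegrableOn (fun t => Real.exp (-z * t) * t ^ p * (1 + t) ^ q) (Ioi 0) := by
  obtain ⟨N, hN⟩ := exists_nat_ge q
  have h1 := integrableOn_rpow_mul_exp_neg_mul_rpow hp one_pos hz
  have h2 := integrableOn_rpow_mul_exp_neg_mul_rpow (s := p + N)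
    (by have : (0 : ℝ) ≤ N := N.cast_nonneg
        linarith) one_pos hz
  refine Integrable.mono' ((h1.add h2).const_mul (2 ^ (N - 1))) ?_ ?_
  · refine ContinuousOn.aestronglyMeasurable ?_ measurableSet_Ioi
    refine ContinuousOn.mul (ContinuousOn.mul (by fun_prop) ?_) (continuousOn_one_add_rpow q)
    exact fun t ht => (Real.continuousAt_rpow_const _ _ (Or.inl (ne_of_gt ht))).continuousWithinAt
  · filter_upwards [ae_restrict_mem measurableSet_Ioi] with t ht
    have ht : 0 < t := ht
    have h3 : (1 + t) ^ q ≤ 2 ^ (N - 1) * (1 + t ^ N) := by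
      calc (1 + t) ^ q ≤ (1 + t) ^ (N : ℝ) :=
            Real.rpow_le_rpow_of_exponent_le (by linarith) hN
        _ = (1 + t) ^ N := Real.rpow_natCast _ _
        _ ≤ 2 ^ (N - 1) * (1 ^ N + t ^ N) := add_pow_le zero_le_one ht.le N
        _ = _ := by rw [one_pow]
    rw [Real.norm_eq_abs, abs_of_nonneg (by positivity)]
    calc Real.exp (-z * t) * t ^ p * (1 + t) ^ q
        ≤ Real.exp (-z * t) * t ^ p * (2 ^ (N - 1) * (1 + t ^ N)) := by gcongr
      _ = _ := by
        simp only [Pi.add_apply, Real.rpow_one]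
        rw [Real.rpow_add ht, Real.rpow_natCast]
        ring

/-- The measure on `(0,∞)` with density `t ^ p * (1 + t) ^ q`. -/
noncomputable def tricomiMeasure (p q : ℝ) : Measure ℝ :=
  (volume.restrict (Ioi 0)).withDensity fun t => ENNReal.ofReal (t ^ p * (1 + t) ^ q)

theorem integral_tricomiMeasure (p q : ℝ) (g : ℝ → ℝ) :
    ∫ t, g t ∂tricomiMeasure p q = ∫ t in Ioi (0 : ℝ), t ^ p * (1 + t) ^ q * g t := by
  rw [tricomiMeasure, integral_withDensity_eq_integral_toReal_smul (by fun_prop) (by simp)]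
  refine setIntegral_congr_fun measurableSet_Ioi fun t ht => ?_
  have ht : 0 < t := ht
  simp only [smul_eq_mul]
  rw [ENNReal.toReal_ofReal (by positivity)]

theorem mem_interior_integrableExpSet_tricomi (hp : -1 < p) (q : ℝ) (hz : 0 < z) :
    -z ∈ interior (ProbabilityTheory.integrableExpSet id (tricomiMeasure p q)) := by
  refine interior_mono (s := Iio 0) (fun x hx => ?_) (by simpa using hz)
  have hx : x < 0 := hx
  simp only [ProbabilityTheory.integrableExpSet, mem_ofPred_eq]
  rw [tricomiMeasure, integrable_withDensity_iff_integrable_smul' (by fun_prop) (by simp)]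
  refine (integrableOn_tricomi hp q (neg_pos.2 hx)).congr_fun (fun t ht => ?_) measurableSet_Ioi
  have ht : 0 < t := ht
  simp only [smul_eq_mul, neg_neg, id]
  rw [ENNReal.toReal_ofReal (by positivity)]
  ring

theorem tricomiIntegral_eq_mgf (p q : ℝ) :
    tricomiIntegral p q = fun z => ProbabilityTheory.mgf id (tricomiMeasure p q) (-z) := by
  funext z
  rw [ProbabilityTheory.mgf, integral_tricomiMeasure, tricomiIntegral]
  congr 1
  funext t
  simp only [id]
  ring

theorem analyticOnNhd_tricomiIntegral (hp : -1 < p) (q : ℝ) :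
    AnalyticOnNhd ℝ (tricomiIntegral p q) (Ioi 0) := by
  intro z hz
  rw [tricomiIntegral_eq_mgf]
  exact (ProbabilityTheory.analyticAt_mgf
    (mem_interior_integrableExpSet_tricomi hp q hz)).fun_comp analyticAt_id.neg

theorem hasDerivAt_tricomiIntegral (hp : -1 < p) (q : ℝ) (hz : 0 < z) :
    HasDerivAt (tricomiIntegral p q) (-tricomiIntegral (p + 1) q z) z := by
  rw [tricomiIntegral_eq_mgf]
  have h := (ProbabilityTheory.hasDerivAt_mgf
    (mem_interior_integrableExpSet_tricomi hp q hz)).comp z (hasDerivAt_neg z)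
  convert! h using 1
  rw [integral_tricomiMeasure, mul_neg_one, neg_inj, tricomiIntegral]
  refine setIntegral_congr_fun measurableSet_Ioi fun t ht => ?_
  simp only [id]
  rw [Real.rpow_add_one (ne_of_gt ht)]
  ring

theorem tricomiIntegral_pos (hp : -1 < p) (q : ℝ) (hz : 0 < z) : 0 < tricomiIntegral p q z := by
  have hpos : ∀ t ∈ Ioi (0 : ℝ), 0 < Real.exp (-z * t) * t ^ p * (1 + t) ^ q := fun t ht => by
    have ht : 0 < t := ht
    positivity
  rw [tricomiIntegral, setIntegral_pos_iff_support_of_nonneg_ae ?_ (integrableOn_tricomi hp q hz)]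
  · have hsub : Ioi (0 : ℝ) ⊆
        Function.support fun t => Real.exp (-z * t) * t ^ p * (1 + t) ^ q :=
      fun t ht => (hpos t ht).ne'
    rw [inter_eq_right.2 hsub]
    simp
  · filter_upwards [ae_restrict_mem measurableSet_Ioi] with t ht using (hpos t ht).le

theorem tricomiIntegral_add_one_right (hp : -1 < p) (q : ℝ) (hz : 0 < z) :
    tricomiIntegral p (q + 1) z = tricomiIntegral p q z + tricomiIntegral (p + 1) q z := by
  unfold tricomiIntegral
  rw [← integral_add (integrableOn_tricomi hp q hz)
    (integrableOn_tricomi (by linarith) q hz)]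
  refine setIntegral_congr_fun measurableSet_Ioi fun t ht => ?_
  have ht : 0 < t := ht
  change Real.exp (-z * t) * t ^ p * (1 + t) ^ (q + 1) =
    Real.exp (-z * t) * t ^ p * (1 + t) ^ q + Real.exp (-z * t) * t ^ (p + 1) * (1 + t) ^ q
  rw [Real.rpow_add_one ht.ne', Real.rpow_add_one (by positivity)]
  ring

/-- Integration by parts in Tricomi's integral. -/
theorem tricomiIntegral_integration_by_parts (hp : -1 < p) (q : ℝ) (hz : 0 < z) :
    z * tricomiIntegral (p + 1) q z =
      (p + 1) * tricomiIntegral p q z + q * tricomiIntegral (p + 1) (q - 1) z := by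
  have i0 := (integrableOn_tricomi (p := p + 1) (by linarith) q hz)
  have i1 := i0.const_mul (-z)
  have i2 := (integrableOn_tricomi hp q hz).const_mul (p + 1)
  have i3 := (integrableOn_tricomi (p := p + 1) (by linarith) (q - 1) hz).const_mul q
  have hd : ∀ t ∈ Ioi (0 : ℝ),
      HasDerivAt (fun t => Real.exp (-z * t) * t ^ (p + 1) * (1 + t) ^ q)
        (-z * (Real.exp (-z * t) * t ^ (p + 1) * (1 + t) ^ q) +
          (p + 1) * (Real.exp (-z * t) * t ^ p * (1 + t) ^ q) +
          q * (Real.exp (-z * t) * t ^ (p + 1) * (1 + t) ^ (q - 1))) t := by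
    intro t ht
    have ht : 0 < t := ht
    have he : HasDerivAt (fun t => Real.exp (-z * t)) (Real.exp (-z * t) * (-z)) t := by
      simpa using ((hasDerivAt_id t).const_mul (-z)).exp
    have hr := Real.hasDerivAt_rpow_const (x := t) (p := p + 1) (Or.inl ht.ne')
    rw [add_sub_cancel_right] at hr
    convert! (he.mul hr).mul (hasDerivAt_one_add_rpow q ht.le) using 1
    simp only [Pi.mul_apply]
    ring
  have hlim := tendsto_zero_of_hasDerivAt_of_integrableOn_Ioi hd ((i1.add i2).add i3) i0
  have hcont : ContinuousWithinAt (fun t => Real.exp (-z * t) * t ^ (p + 1) * (1 + t) ^ q)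
      (Ici 0) 0 := by
    refine ContinuousAt.continuousWithinAt (ContinuousAt.mul (ContinuousAt.mul (by fun_prop) ?_) ?_)
    · exact Real.continuousAt_rpow_const _ _ (Or.inr (by linarith))
    · exact ContinuousAt.rpow_const (by fun_prop) (Or.inl (by norm_num))
  have := integral_Ioi_of_hasDerivAt_of_tendsto hcont hd ((i1.add i2).add i3) hlim
  have i12 : Integrable (fun t => -z * (Real.exp (-z * t) * t ^ (p + 1) * (1 + t) ^ q) +
      (p + 1) * (Real.exp (-z * t) * t ^ p * (1 + t) ^ q)) (volume.restrict (Ioi 0)) := i1.add i2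
  rw [integral_add i12 i3, integral_add i1 i2, integral_const_mul, integral_const_mul,
    integral_const_mul, Real.zero_rpow (by linarith)] at this
  unfold tricomiIntegral
  linarith

end TricomiIntegral

/-- The negated logarithmic derivative of `Psi a c`. -/
noncomputable def tricomiLogDeriv (a c z : ℝ) : ℝ :=
  tricomiIntegral a (c - a - 1) z / tricomiIntegral (a - 1) (c - a - 1) z

section LogDeriv

variable {a c z : ℝ}

theorem analyticOnNhd_tricomiLogDeriv (ha : 0 < a) (c : ℝ) :
    AnalyticOnNhd ℝ (tricomiLogDeriv a c) (Ioi 0) :=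
  (analyticOnNhd_tricomiIntegral (by linarith) _).div
    (analyticOnNhd_tricomiIntegral (by linarith) _)
    fun _ hz => (tricomiIntegral_pos (by linarith) _ hz).ne'

theorem tricomiLogDeriv_nonneg (ha : 0 < a) (c : ℝ) (hz : 0 < z) : 0 ≤ tricomiLogDeriv a c z :=
  (div_pos (tricomiIntegral_pos (by linarith) _ hz)
    (tricomiIntegral_pos (by linarith) _ hz)).le

theorem mul_tricomiLogDeriv_le (ha : 0 < a) (hc : c < 1) (hz : 0 < z) :
    z * tricomiLogDeriv a c z ≤ a := by
  have h := tricomiIntegral_integration_by_parts (p := a - 1) (by linarith) (c - a - 1) hz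
  rw [sub_add_cancel] at h
  have h1 := tricomiIntegral_pos (p := a) (by linarith) (c - a - 1 - 1) hz
  have h2 := tricomiIntegral_pos (p := a - 1) (by linarith) (c - a - 1) hz
  rw [tricomiLogDeriv, ← mul_div_assoc, div_le_iff₀ h2, h]
  nlinarith

/-- The Riccati equation for the logarithmic derivative of `Psi a c`. -/
theorem hasDerivAt_tricomiLogDeriv (ha : 0 < a) (c : ℝ) (hz : 0 < z) :
    ∃ d, HasDerivAt (tricomiLogDeriv a c) d z ∧
      z * d = z * tricomiLogDeriv a c z ^ 2 + (z - c) * tricomiLogDeriv a c z - a := by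
  have h0 := tricomiIntegral_pos (p := a - 1) (by linarith) (c - a - 1) hz
  have d0 := hasDerivAt_tricomiIntegral (p := a - 1) (by linarith) (c - a - 1) hz
  have d1 := hasDerivAt_tricomiIntegral (p := a) (by linarith) (c - a - 1) hz
  have e := tricomiIntegral_integration_by_parts (p := a - 1) (by linarith) (c - a - 1 + 1) hz
  rw [sub_add_cancel] at d0
  rw [sub_add_cancel a 1, add_sub_cancel_right, tricomiIntegral_add_one_right (by linarith) _ hz,
    tricomiIntegral_add_one_right (by linarith) _ hz, sub_add_cancel a 1] at e
  refine ⟨_, d1.div d0 h0.ne', ?_⟩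
  simp only [tricomiLogDeriv]
  field_simp
  linear_combination (-tricomiIntegral (a - 1) (c - a - 1) z) * e

theorem abs_tricomiLogDeriv_le (ha : 0 < a) (hc : c < 1) (hz : 0 < z) :
    |tricomiLogDeriv a c z| ≤ a / z := by
  rw [abs_of_nonneg (tricomiLogDeriv_nonneg ha c hz), le_div_iff₀ hz, mul_comm]
  exact mul_tricomiLogDeriv_le ha hc hz

theorem sub_mul_tricomiLogDeriv_mem (ha : 0 < a) (hc : c < 1) (hz : 0 < z) :
    a - z * tricomiLogDeriv a c z ∈ Icc 0 a :=
  ⟨sub_nonneg.2 (mul_tricomiLogDeriv_le ha hc hz),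
    sub_le_self _ (mul_nonneg hz.le (tricomiLogDeriv_nonneg ha c hz))⟩

theorem continuousOn_tricomiLogDeriv (ha : 0 < a) (c : ℝ) :
    ContinuousOn (tricomiLogDeriv a c) (Ioi 0) :=
  (analyticOnNhd_tricomiLogDeriv ha c).continuousOn

theorem diffCM_sub_mul_tricomiLogDeriv (ha : 0 < a) (hc : c < 1) :
    DiffCM fun z => a - z * tricomiLogDeriv a c z := by
  set G : ℝ → ℝ := fun z => a - z * tricomiLogDeriv a c z with hG
  have hGmem : ∀ z, 0 < z → G z ∈ Icc 0 a := fun z hz => sub_mul_tricomiLogDeriv_mem ha hc hz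
  have hGabs : ∀ z, 0 < z → |G z| ≤ a := fun z hz => by
    rw [abs_of_nonneg (hGmem z hz).1]
    exact (hGmem z hz).2
  set Q : (ℝ → ℝ) → ℝ → ℝ := fun f w => f w * f w + a * (1 + a - c) with hQ
  have hQ0 : 0 ≤ a * (1 + a - c) := mul_nonneg ha.le (by linarith)
  have hβ : -1 ≤ 1 + 2 * a - c := by linarith
  have hQcm : ∀ f, DiffCM f → DiffCM (Q f) := fun f hf => (hf.mul hf).add (DiffCM.const hQ0)
  have hQG : TailIntegrable (1 + 2 * a - c) (Q G) := by
    refine tailIntegrable_of_continuousOn hβ ?_ fun z hz =>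
      ⟨a * a + a * (1 + a - c), fun w hw => ?_⟩
    · have := continuousOn_tricomiLogDeriv ha c
      fun_prop
    · have hw := hGmem w (hz.trans_le hw)
      have : 0 ≤ G w * G w := mul_self_nonneg _
      rw [abs_of_nonneg (by simp only [hQ]; positivity)]
      simp only [hQ]
      nlinarith [hw.1, hw.2]
  have hrep : ∀ z, 0 < z → G z = tailOp (1 + 2 * a - c) (Q G) z := fun z hz => by
    refine eq_tailOp hβ (fun w hw => ?_) (fun w hw => ⟨a, fun v hv => hGabs v (hw.trans_le hv)⟩)
      hQG hz
    obtain ⟨d, hd, he⟩ := hasDerivAt_tricomiLogDeriv ha c hw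
    refine ⟨_, ((hasDerivAt_id w).mul hd).const_sub a, ?_⟩
    simp only [hG, hQ, id]
    linear_combination (-w) * he
  refine DiffCM.of_fixedPoint (C := 2 * a) (M := a) (p := 0) (Q := Q)
    (fun f => ∀ z, 0 < z → f z ≤ G z) hβ (by linarith) (fun z hz => (hGmem z hz).1) ?_ hQcm hQG
    ?_ hrep (by simpa using hGabs)
  · intro f hf hfG z hz
    rw [hrep z hz]
    refine setIntegral_mono_on ((hQcm f hf).tailIntegrable hβ z hz) (hQG z hz) measurableSet_Ioi
      fun r hr => ?_
    have hr : 0 < r := hr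
    have hw : 0 < z * (1 + r) := by positivity
    have h1 := hf.nonneg hw
    have h2 := hfG _ hw
    have h3 := h1.trans h2
    simp only [hQ]
    gcongr
  · intro f hf hfG w hw
    have h1 := hf.nonneg hw
    have h2 := hfG w hw
    have h3 := hGmem w hw
    have : Q G w - Q f w = (G w + f w) * (G w - f w) := by
      simp only [hQ]
      ring
    rw [this, abs_mul, abs_of_nonneg (add_nonneg h3.1 h1)]
    gcongr
    linarith [h3.2]

/-- Solutions of a linear equation `z y' = (z + β) y - F y - H` with completely monotone
coefficients are completely monotone. -/
theorem diffCM_of_linear {β C M : ℝ} {y F H : ℝ → ℝ} (hβ : -1 ≤ β) (hF : DiffCM F)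
    (hH : DiffCM H) (hFc : ContinuousOn F (Ioi 0)) (hHc : ContinuousOn H (Ioi 0))
    (hyc : ContinuousOn y (Ioi 0)) (hFC : ∀ z, 0 < z → F z ≤ C)
    (hyM : ∀ z, 0 < z → |y z| ≤ M / z)
    (hy : ∀ z, 0 < z → ∃ d, HasDerivAt y d z ∧ z * d = (z + β) * y z - (F z * y z + H z)) :
    DiffCM y := by
  have hM : 0 ≤ M := by simpa using (abs_nonneg _).trans (hyM 1 one_pos)
  have hC : 0 ≤ C := (hF.nonneg one_pos).trans (hFC 1 one_pos)
  have hyK : ∀ z, 0 < z → ∀ w, z ≤ w → |y w| ≤ M / z := fun z hz w hw =>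
    (hyM w (hz.trans_le hw)).trans (by gcongr)
  have hQy : TailIntegrable β (fun w => F w * y w + H w) := by
    refine tailIntegrable_of_continuousOn hβ ((hFc.mul hyc).add hHc) fun z hz =>
      ⟨C * (M / z) + H z, fun w hw => ?_⟩
    have hw0 : 0 < w := hz.trans_le hw
    refine (abs_add_le _ _).trans (add_le_add ?_ ?_)
    · rw [abs_mul, abs_of_nonneg (hF.nonneg hw0)]
      exact mul_le_mul (hFC w hw0) (hyK z hz w hw) (abs_nonneg _) hC
    · rw [abs_of_nonneg (hH.nonneg hw0)]
      exact hH.antitoneOn hz hw0 hw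
  refine DiffCM.of_fixedPoint (C := C) (M := M) (p := 1) (Q := fun f w => F w * f w + H w)
    (fun _ => True) hβ hC trivial (fun _ _ _ => trivial) (fun f hf => (hF.mul hf).add hH) hQy
    (fun f _ _ w hw => ?_) (fun z hz => eq_tailOp hβ hy (fun w hw => ⟨_, hyK w hw⟩) hQy hz)
    (by simpa using hyM)
  rw [add_sub_add_right_eq_sub, ← mul_sub, abs_mul, abs_of_nonneg (hF.nonneg hw)]
  exact mul_le_mul_of_nonneg_right (hFC w hw) (abs_nonneg _)

theorem diffCM_tricomiLogDeriv (ha : 0 < a) (hc : c < 1) : DiffCM (tricomiLogDeriv a c) := by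
  have hcont := continuousOn_tricomiLogDeriv ha c
  refine diffCM_of_linear (β := a - c) (C := a) (M := a) (by linarith)
    (diffCM_sub_mul_tricomiLogDeriv ha hc) (DiffCM.const ha.le) (by fun_prop) (by fun_prop) hcont
    (fun z hz => (sub_mul_tricomiLogDeriv_mem ha hc hz).2)
    (fun z hz => abs_tricomiLogDeriv_le ha hc hz) fun z hz => ?_
  obtain ⟨d, hd, he⟩ := hasDerivAt_tricomiLogDeriv ha c hz
  refine ⟨d, hd, ?_⟩
  linear_combination he

theorem diffCM_tricomiLogDeriv_sub {c' : ℝ} (ha : 0 < a) (hcc' : c' < c) (hc : c < 1) :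
    DiffCM fun z => tricomiLogDeriv a c z - tricomiLogDeriv a c' z := by
  have hc' : c' < 1 := hcc'.trans hc
  have hcont := continuousOn_tricomiLogDeriv ha c
  have hcont' := continuousOn_tricomiLogDeriv ha c'
  refine diffCM_of_linear (β := 2 * a - c) (C := a + a) (M := a) (by linarith)
    ((diffCM_sub_mul_tricomiLogDeriv ha hc).add (diffCM_sub_mul_tricomiLogDeriv ha hc'))
    ((diffCM_tricomiLogDeriv ha hc').const_mul (sub_pos.2 hcc').le) (by fun_prop) (by fun_prop)
    (by fun_prop) (fun z hz => add_le_add (sub_mul_tricomiLogDeriv_mem ha hc hz).2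
      (sub_mul_tricomiLogDeriv_mem ha hc' hz).2) (fun z hz => ?_) fun z hz => ?_
  · have h1 := (abs_le.1 (abs_tricomiLogDeriv_le ha hc hz)).2
    have h2 := (abs_le.1 (abs_tricomiLogDeriv_le ha hc' hz)).2
    have h3 := tricomiLogDeriv_nonneg ha c hz
    have h4 := tricomiLogDeriv_nonneg ha c' hz
    exact abs_le.2 ⟨by linarith, by linarith⟩
  · obtain ⟨d, hd, he⟩ := hasDerivAt_tricomiLogDeriv ha c hz
    obtain ⟨d', hd', he'⟩ := hasDerivAt_tricomiLogDeriv ha c' hz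
    refine ⟨_, hd.sub hd', ?_⟩
    linear_combination he - he'

end LogDeriv

theorem Psi_div_Psi {a : ℝ} (ha : 0 < a) (c c' : ℝ) :
    (fun w => Psi a c w / Psi a c' w) = fun w =>
      tricomiIntegral (a - 1) (c - a - 1) w / tricomiIntegral (a - 1) (c' - a - 1) w := by
  funext w
  exact mul_div_mul_left _ _ (one_div_ne_zero (Real.Gamma_pos_of_pos ha).ne')

/-- Corollary 1: for `a > 0` and `c' < c < 1`, the ratio `z ↦ Ψ(a,c,z)/Ψ(a,c',z)`
is completely monotone on `(0,∞)`. -/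
theorem Psi_ratio_CM (a c c' : ℝ) (ha : 0 < a) (hcc' : c' < c) (hc : c < 1) :
    ∀ n : ℕ, ∀ z : ℝ, 0 < z →
      0 ≤ (-1 : ℝ) ^ n * iteratedDeriv n (fun w => Psi a c w / Psi a c' w) z := by
  intro n z hz
  have hp : -1 < a - 1 := by linarith
  rw [Psi_div_Psi ha]
  refine iteratedDeriv_nonneg_of_deriv_eq_neg_mul (diffCM_tricomiLogDeriv_sub ha hcc' hc)
    ((analyticOnNhd_tricomiLogDeriv ha c).sub (analyticOnNhd_tricomiLogDeriv ha c'))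
    ((analyticOnNhd_tricomiIntegral hp _).div (analyticOnNhd_tricomiIntegral hp _)
      fun w hw => (tricomiIntegral_pos hp _ hw).ne')
    (fun w hw => (div_pos (tricomiIntegral_pos hp _ hw) (tricomiIntegral_pos hp _ hw)).le)
    (fun w hw => ?_) n hz
  have h := tricomiIntegral_pos hp (c - a - 1) hw
  have h' := tricomiIntegral_pos hp (c' - a - 1) hw
  have hd := (hasDerivAt_tricomiIntegral hp (c - a - 1) hw).div
    (hasDerivAt_tricomiIntegral hp (c' - a - 1) hw) h'.ne'
  refine hd.deriv.trans ?_
  simp only [tricomiLogDeriv, sub_add_cancel]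
  field_simp
  ring
end

section
/- Let a ∈ (0,1] and c' < c < 1. Then the function z ↦ Ψ(a,c,z)/Ψ(a,c',z) is logarithmically completely monotone on (0,∞), i.e. the function z ↦ −(d/dz) log(Ψ(a,c,z)/Ψ(a,c',z)) is completely monotone on (0,∞). -/
open MeasureTheory Set

/-- Kaluza's theorem: the reciprocal of a power series with positive log-convex coefficients `c`
and `c 0 = 1` has nonpositive coefficients, apart from the constant one. -/
theorem kaluza_coeff_nonpos {c r q : ℕ → ℝ} (hc0 : c 0 = 1) (hc : ∀ n, 0 < c n)
    (hr : Monotone r) (hcr : ∀ n, c (n + 1) = c n * r n)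
    (hq : ∀ n, ∑ j ∈ Finset.range (n + 2), q j * c (n + 1 - j) = 0) (hq0 : q 0 = 1) (n : ℕ) :
    q (n + 1) ≤ 0 := by
  induction n using Nat.strong_induction_on with
  | _ n ih =>
    have h1 := hq n
    rw [Finset.sum_range_succ] at h1
    simp only [Nat.sub_self, hc0, mul_one] at h1
    have h2 : ∑ j ∈ Finset.range (n + 1), q j * c (n + 1 - j) =
        ∑ j ∈ Finset.range (n + 1), q j * (c (n - j) * r (n - j)) := by
      refine Finset.sum_congr rfl fun j hj => ?_
      rw [Nat.succ_sub (Finset.mem_range_succ_iff.mp hj), hcr]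
    rw [h2] at h1
    cases n with
    | zero =>
      simp only [Finset.sum_range_one, hq0, hc0, Nat.sub_zero, zero_add] at h1 ⊢
      have h3 : 0 < c 1 := hc 1
      rw [show (1 : ℕ) = 0 + 1 from rfl, hcr 0, hc0] at h3
      linarith
    | succ m =>
      have h3 : ∑ j ∈ Finset.range (m + 2),
          (q j * (c (m + 1 - j) * r (m + 1 - j)) - r (m + 1) * (q j * c (m + 1 - j))) ≥ 0 := by
        refine Finset.sum_nonneg fun j hj => ?_
        cases j with
        | zero => simp [mul_comm, mul_left_comm]
        | succ i =>
          have hi : q (i + 1) ≤ 0 := ih i (by simp at hj; omega)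
          have hm : r (m + 1 - (i + 1)) ≤ r (m + 1) := hr (Nat.sub_le _ _)
          have := mul_nonneg (mul_nonneg (neg_nonneg.mpr hi) (hc (m + 1 - (i + 1))).le)
            (sub_nonneg.mpr hm)
          linarith
      rw [Finset.sum_sub_distrib, ← Finset.mul_sum, hq m] at h3
      linarith

/-- Multiplying positive log-convex coefficients by an increasing sequence and dividing by the
original series gives nonnegative coefficients. -/
theorem kaluza_quotient_nonneg {c r q h : ℕ → ℝ} (hc0 : c 0 = 1) (hc : ∀ n, 0 < c n)
    (hr : Monotone r) (hcr : ∀ n, c (n + 1) = c n * r n)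
    (hq : ∀ n, ∑ j ∈ Finset.range (n + 2), q j * c (n + 1 - j) = 0) (hq0 : q 0 = 1)
    (hh : Monotone h) (n : ℕ) :
    0 ≤ ∑ j ∈ Finset.range (n + 2), q j * (c (n + 1 - j) * h (n + 1 - j)) := by
  have h3 : ∑ j ∈ Finset.range (n + 2),
      (q j * (c (n + 1 - j) * h (n + 1 - j)) - h (n + 1) * (q j * c (n + 1 - j))) ≥ 0 := by
    refine Finset.sum_nonneg fun j _ => ?_
    cases j with
    | zero => simp [mul_comm, mul_left_comm]
    | succ i =>
      have hi := kaluza_coeff_nonpos hc0 hc hr hcr hq hq0 i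
      have hm : h (n + 1 - (i + 1)) ≤ h (n + 1) := hh (Nat.sub_le _ _)
      have := mul_nonneg (mul_nonneg (neg_nonneg.mpr hi) (hc (n + 1 - (i + 1))).le)
        (sub_nonneg.mpr hm)
      linarith
  rw [Finset.sum_sub_distrib, ← Finset.mul_sum, hq n] at h3
  linarith

theorem PowerSeries.coeff_mul_eq_sum_range {R : Type*} [CommSemiring R] (φ ψ : PowerSeries R)
    (n : ℕ) : PowerSeries.coeff n (φ * ψ) =
      ∑ j ∈ Finset.range (n + 1), PowerSeries.coeff j φ * PowerSeries.coeff (n - j) ψ := by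
  rw [PowerSeries.coeff_mul, Finset.Nat.sum_antidiagonal_eq_sum_range_succ_mk]

/-- The coefficients of the logarithmic derivative of a power series with positive log-convex
coefficients are monotone under an infinitesimal increase of the coefficient ratios. -/
theorem exists_hasDerivAt_logDeriv_coeff {C k : ℝ → ℕ → ℝ} {r h : ℕ → ℝ} {θ : ℝ}
    (hC0 : ∀ s, C s 0 = 1) (hC : ∀ n, 0 < C θ n) (hr : Monotone r)
    (hCr : ∀ n, C θ (n + 1) = C θ n * r n) (hh : Monotone h)
    (hd : ∀ n, HasDerivAt (fun s => C s n) (C θ n * h n) θ)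
    (hk : ∀ s n, ∑ j ∈ Finset.range (n + 1), k s j * C s (n - j) = (n + 1) * C s (n + 1))
    (n : ℕ) : ∃ d, 0 ≤ d ∧ HasDerivAt (fun s => k s n) d θ := by
  let P : PowerSeries ℝ := PowerSeries.mk (C θ)
  let D : PowerSeries ℝ := PowerSeries.mk fun n => C θ n * h n
  let K : PowerSeries ℝ := PowerSeries.mk (k θ)
  have hP0 : PowerSeries.constantCoeff P ≠ 0 := by
    rw [← PowerSeries.coeff_zero_eq_constantCoeff_apply]; simp [P, hC0]
  let g : PowerSeries ℝ := P⁻¹ * D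
  have hQP : P⁻¹ * P = 1 := PowerSeries.inv_mul_cancel _ hP0
  have hgP : g * P = D := by
    rw [mul_right_comm, hQP, one_mul]
  have hKP : K * P = PowerSeries.derivative ℝ P := by
    ext m
    rw [PowerSeries.coeff_mul_eq_sum_range, PowerSeries.coeff_derivative]
    simp only [K, P, PowerSeries.coeff_mk]
    rw [hk, mul_comm]
  have key : PowerSeries.derivative ℝ g * P + K * D = PowerSeries.derivative ℝ D := by
    have := congrArg (PowerSeries.derivative ℝ) hgP
    rw [Derivation.leibniz, ← hKP, smul_eq_mul, smul_eq_mul] at this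
    rw [← this, ← hgP]; ring
  refine ⟨PowerSeries.coeff n (PowerSeries.derivative ℝ g), ?_, ?_⟩
  · rw [PowerSeries.coeff_derivative, PowerSeries.coeff_mul_eq_sum_range]
    refine mul_nonneg ?_ (by positivity)
    simp only [D, PowerSeries.coeff_mk]
    refine kaluza_quotient_nonneg (hC0 θ) hC hr hCr (fun m => ?_) ?_ hh n
    · have := congrArg (PowerSeries.coeff (m + 1)) hQP
      rw [PowerSeries.coeff_mul_eq_sum_range] at this
      simpa [P, PowerSeries.coeff_one] using this
    · simp [P, hC0]
  · induction n using Nat.strong_induction_on with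
    | _ n ih =>
      have hform : (fun s => k s n) = fun s => (n + 1) * C s (n + 1) -
          ∑ j ∈ Finset.range n, k s j * C s (n - j) := by
        funext s
        have := hk s n
        rw [Finset.sum_range_succ, Nat.sub_self, hC0, mul_one] at this
        linarith
      rw [hform]
      have hsum : HasDerivAt (fun s => ∑ j ∈ Finset.range n, k s j * C s (n - j))
          (∑ j ∈ Finset.range n, (PowerSeries.coeff j (PowerSeries.derivative ℝ g) * C θ (n - j)
            + k θ j * (C θ (n - j) * h (n - j)))) θ :=
        HasDerivAt.fun_sum fun j hj => (ih j (Finset.mem_range.mp hj)).mul (hd (n - j))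
      refine (((hd (n + 1)).const_mul ((n : ℝ) + 1)).sub hsum).congr_deriv ?_
      have hc := congrArg (PowerSeries.coeff n) key
      have hh0 : k θ n * (C θ 0 * h 0) = 0 := by
        have := (hd 0).unique (by simpa [hC0] using hasDerivAt_const θ (1 : ℝ))
        rw [this, mul_zero]
      rw [map_add, PowerSeries.coeff_mul_eq_sum_range, PowerSeries.coeff_mul_eq_sum_range,
        Finset.sum_range_succ, Finset.sum_range_succ, PowerSeries.coeff_derivative D] at hc
      simp only [P, D, K, PowerSeries.coeff_mk, Nat.sub_self, hC0 θ] at hc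
      rw [hC0] at hh0
      rw [Finset.sum_add_distrib]
      linarith

/-- The sequence of coefficients of `C' / C` where `C = ∑ c n X ^ n` and `c 0 ≠ 0`. -/
noncomputable def logDerivCoeff (c : ℕ → ℝ) (n : ℕ) : ℝ :=
  PowerSeries.coeff n (PowerSeries.derivative ℝ (PowerSeries.mk c) * (PowerSeries.mk c)⁻¹)

theorem sum_logDerivCoeff {c : ℕ → ℝ} (hc : c 0 ≠ 0) (n : ℕ) :
    ∑ j ∈ Finset.range (n + 1), logDerivCoeff c j * c (n - j) = (n + 1) * c (n + 1) := by
  have hP0 : PowerSeries.constantCoeff (PowerSeries.mk c) ≠ 0 := by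
    rw [← PowerSeries.coeff_zero_eq_constantCoeff_apply]; simpa using hc
  have := congrArg (PowerSeries.coeff n) (show PowerSeries.derivative ℝ (PowerSeries.mk c) *
    (PowerSeries.mk c)⁻¹ * PowerSeries.mk c = PowerSeries.derivative ℝ (PowerSeries.mk c) by
      rw [mul_assoc, PowerSeries.inv_mul_cancel _ hP0, mul_one])
  rw [PowerSeries.coeff_mul_eq_sum_range, PowerSeries.coeff_derivative] at this
  simpa [logDerivCoeff, mul_comm] using this

theorem eq_logDerivCoeff {c k : ℕ → ℝ} {x : ℝ} (hx : x ≠ 0) (hc : c 0 = 1)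
    (hk : ∀ n : ℕ, ∑ j ∈ Finset.range (n + 1), k j * (x * c (n - j)) = (n + 1) * (x * c (n + 1)))
    (n : ℕ) : k n = logDerivCoeff c n := by
  induction n using Nat.strong_induction_on with
  | _ n ih =>
    have h1 := sum_logDerivCoeff (c := c) (by simp [hc]) n
    have h2 : ∑ j ∈ Finset.range (n + 1), k j * c (n - j) = (n + 1) * c (n + 1) := by
      apply mul_left_cancel₀ hx
      rw [Finset.mul_sum, mul_left_comm, ← hk n]
      exact Finset.sum_congr rfl fun j _ => by ring
    rw [Finset.sum_range_succ, Nat.sub_self, hc, mul_one] at h1 h2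
    rw [Finset.sum_congr rfl fun j hj => by rw [ih j (Finset.mem_range.mp hj)]] at h2
    linarith

theorem logDerivCoeff_prod_le {a b : ℕ → ℝ} (ha : Monotone a) (hb : Monotone b)
    (hb0 : ∀ n, 0 < b n) (hab : ∀ n, b n ≤ a n) (n : ℕ) :
    logDerivCoeff (fun m => ∏ i ∈ Finset.range m, b i) n ≤
      logDerivCoeff (fun m => ∏ i ∈ Finset.range m, a i) n := by
  let r : ℝ → ℕ → ℝ := fun s i => b i + s * (a i - b i)
  let C : ℝ → ℕ → ℝ := fun s m => ∏ i ∈ Finset.range m, r s i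
  have hC0 : ∀ s, C s 0 = 1 := fun s => by simp [C]
  have hkey : ∀ s ∈ Set.Icc (0 : ℝ) 1,
      ∃ d, 0 ≤ d ∧ HasDerivAt (fun s => logDerivCoeff (C s) n) d s := by
    intro s hs
    have hrpos : ∀ i, 0 < r s i := fun i =>
      add_pos_of_pos_of_nonneg (hb0 i) (mul_nonneg hs.1 (sub_nonneg.mpr (hab i)))
    refine exists_hasDerivAt_logDeriv_coeff (C := C) (k := fun s => logDerivCoeff (C s)) (r := r s)
      (h := fun m => ∑ i ∈ Finset.range m, (a i - b i) / r s i) hC0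
      (fun m => Finset.prod_pos fun i _ => hrpos i) ?_ (fun m => Finset.prod_range_succ _ _) ?_ ?_
      (fun t m => sum_logDerivCoeff (by simp [hC0]) m) n
    · intro i j hij
      have := mul_le_mul_of_nonneg_left (ha hij) hs.1
      have := mul_le_mul_of_nonneg_left (hb hij) (sub_nonneg.mpr hs.2)
      simp only [r]
      linarith
    · refine monotone_nat_of_le_succ fun m => ?_
      rw [Finset.sum_range_succ]
      exact le_add_of_nonneg_right (div_nonneg (sub_nonneg.mpr (hab m)) (hrpos m).le)
    · intro m
      induction m with
      | zero => simpa [C] using hasDerivAt_const s (1 : ℝ)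
      | succ m ih =>
        have hr' : HasDerivAt (fun t => r t m) (a m - b m) s := by
          simpa [r] using ((hasDerivAt_id s).mul_const (a m - b m)).const_add (b m)
        have := ih.mul hr'
        simp only [C, Finset.prod_range_succ, Finset.sum_range_succ] at this ⊢
        refine this.congr_deriv ?_
        have := (hrpos m).ne'
        field_simp
  choose! d hd0 hd using hkey
  have hmono : MonotoneOn (fun s => logDerivCoeff (C s) n) (Set.Icc 0 1) := by
    refine monotoneOn_of_hasDerivWithinAt_nonneg (f' := d) (convex_Icc 0 1)
      (fun s hs => (hd s hs).continuousAt.continuousWithinAt)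
      (fun s hs => (hd s (interior_subset hs)).hasDerivWithinAt)
      (fun s hs => hd0 s (interior_subset hs))
  simpa [C, r] using hmono (Set.left_mem_Icc.mpr zero_le_one) (Set.right_mem_Icc.mpr zero_le_one)
    zero_le_one

/-- If two positive log-convex sequences have increasing quotient, then the logarithmic
derivatives of their generating series compare coefficientwise. -/
theorem logDeriv_coeff_le {A B k l : ℕ → ℝ} (hA : ∀ n, 0 < A n) (hB : ∀ n, 0 < B n)
    (hAc : ∀ n, A (n + 1) * A (n + 1) ≤ A n * A (n + 2))
    (hBc : ∀ n, B (n + 1) * B (n + 1) ≤ B n * B (n + 2))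
    (hAB : ∀ n, A n * B (n + 1) ≤ A (n + 1) * B n)
    (hk : ∀ n : ℕ, ∑ j ∈ Finset.range (n + 1), k j * A (n - j) = (n + 1) * A (n + 1))
    (hl : ∀ n : ℕ, ∑ j ∈ Finset.range (n + 1), l j * B (n - j) = (n + 1) * B (n + 1))
    (n : ℕ) : l n ≤ k n := by
  have hprod : ∀ {A : ℕ → ℝ}, (∀ n, 0 < A n) →
      ∀ m, A m = A 0 * ∏ i ∈ Finset.range m, A (i + 1) / A i := by
    intro A hA m
    induction m with
    | zero => simp
    | succ m ih =>
      rw [Finset.prod_range_succ, ← mul_assoc, ← ih, mul_div_cancel₀ _ (hA m).ne']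
  have hmono : ∀ {A : ℕ → ℝ}, (∀ n, 0 < A n) →
      (∀ n, A (n + 1) * A (n + 1) ≤ A n * A (n + 2)) → Monotone fun i => A (i + 1) / A i := by
    intro A hA hAc
    refine monotone_nat_of_le_succ fun m => ?_
    rw [div_le_div_iff₀ (hA m) (hA (m + 1))]
    linarith [hAc m]
  rw [eq_logDerivCoeff (k := l) (hB 0).ne' (c := fun m => ∏ i ∈ Finset.range m, B (i + 1) / B i)
      (by simp) (fun m => by simpa only [← hprod hB] using hl m) n,
    eq_logDerivCoeff (k := k) (hA 0).ne' (c := fun m => ∏ i ∈ Finset.range m, A (i + 1) / A i)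
      (by simp) (fun m => by simpa only [← hprod hA] using hk m) n]
  refine logDerivCoeff_prod_le (hmono hA hAc) (hmono hB hBc)
    (fun m => div_pos (hB _) (hB _)) (fun m => ?_) n
  rw [div_le_div_iff₀ (hB m) (hA m)]
  linarith [hAB m]

/-- Chebyshev's association inequality for the identity and an antitone function. -/
theorem integral_mul_mul_integral_le_of_antitoneOn {w p : ℝ → ℝ} (hw : ∀ t ∈ Ioi (0 : ℝ), 0 ≤ w t)
    (hp : AntitoneOn p (Ioi 0)) (hi : IntegrableOn w (Ioi 0))
    (hit : IntegrableOn (fun t => w t * t) (Ioi 0)) (hip : IntegrableOn (fun t => w t * p t) (Ioi 0))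
    (hitp : IntegrableOn (fun t => w t * t * p t) (Ioi 0)) (h0 : 0 < ∫ t in Ioi 0, w t)
    (h1 : 0 < ∫ t in Ioi 0, w t * t) :
    (∫ t in Ioi 0, w t * t * p t) * ∫ t in Ioi 0, w t ≤
      (∫ t in Ioi 0, w t * t) * ∫ t in Ioi 0, w t * p t := by
  obtain ⟨m, hm⟩ : ∃ m, m = (∫ t in Ioi 0, w t * t) / ∫ t in Ioi 0, w t := ⟨_, rfl⟩
  have hm0 : 0 < m := hm ▸ div_pos h1 h0
  have hle : ∫ t in Ioi 0, (w t * t * p t - m * (w t * p t) - p m * (w t * t) + p m * m * w t)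
      ≤ 0 := by
    refine setIntegral_nonpos measurableSet_Ioi fun t ht => ?_
    have hsgn : (t - m) * (p t - p m) ≤ 0 := by
      rcases le_total t m with h | h
      · exact mul_nonpos_of_nonpos_of_nonneg (sub_nonpos.mpr h) (sub_nonneg.mpr (hp ht hm0 h))
      · exact mul_nonpos_of_nonneg_of_nonpos (sub_nonneg.mpr h) (sub_nonpos.mpr (hp hm0 ht h))
    have := mul_nonpos_of_nonneg_of_nonpos (hw t ht) hsgn
    linarith
  have hsub : IntegrableOn (fun t => w t * t * p t - m * (w t * p t)) (Ioi 0) :=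
    hitp.sub (hip.const_mul m)
  have hsub' : IntegrableOn (fun t => w t * t * p t - m * (w t * p t) - p m * (w t * t)) (Ioi 0) :=
    hsub.sub (hit.const_mul (p m))
  rw [integral_add hsub' (hi.const_mul _), integral_sub hsub (hit.const_mul (p m)),
    integral_sub hitp (hip.const_mul m), integral_const_mul, integral_const_mul,
    integral_const_mul] at hle
  have hmw : (∫ t in Ioi 0, w t * t) = m * ∫ t in Ioi 0, w t := by
    rw [hm, div_mul_cancel₀ _ h0.ne']
  rw [hmw] at hle ⊢
  nlinarith

/-- The integrand of Tricomi's integral, with exponent `b` of `1 + t`. -/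
noncomputable def tricomiKernel (a b z t : ℝ) : ℝ :=
  Real.exp (-z * t) * t ^ (a - 1) * (1 + t) ^ b

/-- The moments of Tricomi's integrand. -/
noncomputable def tricomiMoment (a b z : ℝ) (n : ℕ) : ℝ :=
  ∫ t in Ioi (0 : ℝ), t ^ n * tricomiKernel a b z t

theorem tricomiKernel_pos (a b z : ℝ) {t : ℝ} (ht : 0 < t) : 0 < tricomiKernel a b z t := by
  unfold tricomiKernel
  positivity

theorem measurable_tricomiKernel (a b z : ℝ) : Measurable (tricomiKernel a b z) := by
  unfold tricomiKernel
  fun_prop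

theorem integrableOn_pow_mul_tricomiKernel {a b z : ℝ} (ha : 0 < a) (hb : b ≤ 0) (hz : 0 < z)
    (n : ℕ) : IntegrableOn (fun t => t ^ n * tricomiKernel a b z t) (Ioi 0) := by
  have h := integrableOn_rpow_mul_exp_neg_mul_rpow (p := 1) (s := n + (a - 1)) (b := z)
    (by have := n.cast_nonneg (α := ℝ); linarith) one_pos hz
  refine h.mono' ((measurable_id.pow_const n).mul
    (measurable_tricomiKernel a b z)).aestronglyMeasurable ?_
  refine (ae_restrict_mem measurableSet_Ioi).mono fun t (ht : 0 < t) => ?_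
  have h1 : (1 + t) ^ b ≤ 1 := Real.rpow_le_one_of_one_le_of_nonpos (by linarith) hb
  have hk := tricomiKernel_pos a b z ht
  rw [Real.norm_of_nonneg (by positivity), Real.rpow_add ht, Real.rpow_natCast, Real.rpow_one,
    tricomiKernel]
  have : 0 ≤ t ^ n * t ^ (a - 1) * Real.exp (-z * t) := by positivity
  nlinarith

theorem tricomiMoment_pos {a b z : ℝ} (ha : 0 < a) (hb : b ≤ 0) (hz : 0 < z) (n : ℕ) :
    0 < tricomiMoment a b z n := by
  have hpos : ∀ t : ℝ, 0 < t → 0 < t ^ n * tricomiKernel a b z t := fun t ht =>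
    mul_pos (pow_pos ht n) (tricomiKernel_pos a b z ht)
  rw [tricomiMoment, setIntegral_pos_iff_support_of_nonneg_ae
    ((ae_restrict_mem measurableSet_Ioi).mono fun t ht => (hpos t ht).le)
    (integrableOn_pow_mul_tricomiKernel ha hb hz n)]
  have hsub : Ioi (0 : ℝ) ⊆ Function.support fun t => t ^ n * tricomiKernel a b z t :=
    fun t ht => (hpos t ht).ne'
  rw [Set.inter_eq_right.mpr hsub]
  simp

theorem integrableOn_div_one_add_tricomiKernel {a b z : ℝ} (ha : 0 < a) (hb : b ≤ 0) (hz : 0 < z)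
    (n : ℕ) : IntegrableOn (fun t => t ^ n * tricomiKernel a b z t / (1 + t)) (Ioi 0) := by
  refine (integrableOn_pow_mul_tricomiKernel ha hb hz n).mono'
    (((measurable_id.pow_const n).mul (measurable_tricomiKernel a b z)).div
      (measurable_id.const_add 1)).aestronglyMeasurable ?_
  refine (ae_restrict_mem measurableSet_Ioi).mono fun t (ht : 0 < t) => ?_
  have hk := tricomiKernel_pos a b z ht
  rw [Real.norm_of_nonneg (by positivity)]
  exact div_le_self (by positivity) (by linarith)

theorem integrableOn_mul_logDeriv_tricomiKernel {a b z : ℝ} (ha : 0 < a) (hb : b ≤ 0) (hz : 0 < z)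
    (n : ℕ) : IntegrableOn (fun t => t ^ (n + 1) * tricomiKernel a b z t *
      (z + (1 - a) / t - b / (1 + t))) (Ioi 0) := by
  have h := (((integrableOn_pow_mul_tricomiKernel ha hb hz (n + 1)).const_mul z).add
    ((integrableOn_pow_mul_tricomiKernel ha hb hz n).const_mul (1 - a))).sub
    ((integrableOn_div_one_add_tricomiKernel ha hb hz (n + 1)).const_mul b)
  refine IntegrableOn.congr_fun h (fun t (ht : 0 < t) => ?_) measurableSet_Ioi
  simp only [Pi.add_apply, Pi.sub_apply]
  have := ht.ne'
  have : 1 + t ≠ 0 := by positivity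
  field_simp
  ring

theorem integral_mul_logDeriv_tricomiKernel {a b z : ℝ} (ha : 0 < a) (hb : b ≤ 0) (hz : 0 < z)
    (n : ℕ) : ∫ t in Ioi 0, t ^ (n + 1) * tricomiKernel a b z t *
      (z + (1 - a) / t - b / (1 + t)) = (n + 1) * tricomiMoment a b z n := by
  have hna : 0 < n + a := by positivity
  have hintegrable := ((integrableOn_pow_mul_tricomiKernel ha hb hz n).const_mul ((n : ℝ) + 1)).sub
    (integrableOn_mul_logDeriv_tricomiKernel ha hb hz n)
  have h := integral_Ioi_of_hasDerivAt_of_tendsto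
    (f := fun t => t ^ (n + a) * Real.exp (-z * t) * (1 + t) ^ b) (a := 0) (m := 0)
    ?_ (fun t (ht : 0 < t) => ?_) hintegrable ?_
  · simp only [Pi.sub_apply] at h
    rw [integral_sub ((integrableOn_pow_mul_tricomiKernel ha hb hz n).const_mul _)
      (integrableOn_mul_logDeriv_tricomiKernel ha hb hz n), integral_const_mul,
      Real.zero_rpow hna.ne'] at h
    rw [tricomiMoment]
    linarith
  · have h1 : ContinuousAt (fun t : ℝ => t ^ (n + a)) 0 :=
      Real.continuousAt_rpow_const _ _ (Or.inr hna.le)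
    have h2 : ContinuousAt (fun t : ℝ => (1 + t) ^ b) 0 :=
      (continuousAt_const.add continuousAt_id).rpow_const (Or.inl (by simp))
    exact ((h1.mul (by fun_prop)).mul h2).continuousWithinAt
  · have h1t : 0 < 1 + t := by linarith
    have h1 := Real.hasDerivAt_rpow_const (x := t) (p := n + a) (Or.inl ht.ne')
    have h2 : HasDerivAt (fun t => Real.exp (-z * t)) (Real.exp (-z * t) * -z) t := by
      simpa using ((hasDerivAt_id t).const_mul (-z)).exp
    have h3 : HasDerivAt (fun t : ℝ => (1 + t) ^ b) (b * (1 + t) ^ (b - 1)) t := by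
      simpa using ((hasDerivAt_id t).const_add 1).rpow_const (p := b) (Or.inl h1t.ne')
    refine ((h1.mul h2).mul h3).congr_deriv ?_
    have e1 : t ^ ((n : ℝ) + a - 1) = t ^ n * t ^ (a - 1) := by
      rw [add_sub_assoc, Real.rpow_add ht, Real.rpow_natCast]
    have e2 : t ^ ((n : ℝ) + a) = t ^ n * t ^ (a - 1) * t := by
      rw [← e1, ← Real.rpow_add_one ht.ne', sub_add_cancel]
    simp only [Pi.sub_apply, Pi.mul_apply, tricomiKernel]
    rw [e1, e2, Real.rpow_sub_one h1t.ne']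
    have := ht.ne'
    have := h1t.ne'
    field_simp
    ring
  · refine squeeze_zero' ?_ ?_ (tendsto_rpow_mul_exp_neg_mul_atTop_nhds_zero (n + a) z hz)
    · filter_upwards [Filter.eventually_gt_atTop 0] with t ht
      positivity
    · filter_upwards [Filter.eventually_gt_atTop 0] with t ht
      exact mul_le_of_le_one_right (by positivity)
        (Real.rpow_le_one_of_one_le_of_nonpos (by linarith) hb)

theorem tricomiMoment_log_convex {a b z : ℝ} (ha : 0 < a) (ha1 : a ≤ 1) (hb : b ≤ 0) (hz : 0 < z)
    (n : ℕ) : (n + 2) * (tricomiMoment a b z (n + 1) * tricomiMoment a b z (n + 1)) ≤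
      (n + 1) * (tricomiMoment a b z n * tricomiMoment a b z (n + 2)) := by
  have hmul : ∀ t, t ^ (n + 1) * tricomiKernel a b z t * t =
      t ^ (n + 1 + 1) * tricomiKernel a b z t := fun t => by ring
  have h := integral_mul_mul_integral_le_of_antitoneOn
    (w := fun t => t ^ (n + 1) * tricomiKernel a b z t)
    (p := fun t => z + (1 - a) / t - b / (1 + t))
    (fun t (ht : 0 < t) => (mul_pos (pow_pos ht _) (tricomiKernel_pos a b z ht)).le)
    (fun s (hs : 0 < s) t (ht : 0 < t) hst => by
      have h1 : (1 - a) / t ≤ (1 - a) / s := div_le_div_of_nonneg_left (by linarith) hs hst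
      have h2 : (-b) / (1 + t) ≤ (-b) / (1 + s) :=
        div_le_div_of_nonneg_left (by linarith) (by linarith) (by linarith)
      simp only [neg_div] at h2
      simp only
      linarith)
    (integrableOn_pow_mul_tricomiKernel ha hb hz (n + 1))
    (by simpa only [hmul] using integrableOn_pow_mul_tricomiKernel ha hb hz (n + 2))
    (integrableOn_mul_logDeriv_tricomiKernel ha hb hz n)
    (by simpa only [hmul] using integrableOn_mul_logDeriv_tricomiKernel ha hb hz (n + 1))
    (tricomiMoment_pos ha hb hz (n + 1))
    (by simp only [hmul]; exact tricomiMoment_pos ha hb hz (n + 2))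
  simp only [hmul] at h
  rw [integral_mul_logDeriv_tricomiKernel ha hb hz,
    integral_mul_logDeriv_tricomiKernel ha hb hz] at h
  change _ * tricomiMoment a b z (n + 1) ≤ tricomiMoment a b z (n + 2) * _ at h
  push_cast at h
  linarith

theorem tricomiMoment_mul_le {a b b' z : ℝ} (ha : 0 < a) (hb : b ≤ 0) (hbb' : b' ≤ b)
    (hz : 0 < z) (n : ℕ) : tricomiMoment a b z n * tricomiMoment a b' z (n + 1) ≤
      tricomiMoment a b z (n + 1) * tricomiMoment a b' z n := by
  have hb' : b' ≤ 0 := hbb'.trans hb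
  have hmul : ∀ t, t ^ n * tricomiKernel a b' z t * t = t ^ (n + 1) * tricomiKernel a b' z t :=
    fun t => by ring
  have hker : ∀ m : ℕ, EqOn (fun t => -(t ^ m * tricomiKernel a b z t))
      (fun t => t ^ m * tricomiKernel a b' z t * -(1 + t) ^ (b - b')) (Ioi 0) := by
    intro m t (ht : 0 < t)
    have h1t : 0 < 1 + t := by linarith
    have e : (1 + t) ^ b = (1 + t) ^ b' * (1 + t) ^ (b - b') := by
      rw [← Real.rpow_add h1t, add_sub_cancel]
    simp only [tricomiKernel, e]
    ring
  have hintegrable : ∀ m : ℕ, IntegrableOn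
      (fun t => t ^ m * tricomiKernel a b' z t * -(1 + t) ^ (b - b')) (Ioi 0) := fun m =>
    (integrableOn_pow_mul_tricomiKernel ha hb hz m).neg.congr_fun (hker m) measurableSet_Ioi
  have hval : ∀ m : ℕ, ∫ t in Ioi 0, t ^ m * tricomiKernel a b' z t * -(1 + t) ^ (b - b') =
      -tricomiMoment a b z m := fun m => by
    rw [← setIntegral_congr_fun measurableSet_Ioi (hker m), integral_neg, tricomiMoment]
  have h := integral_mul_mul_integral_le_of_antitoneOn
    (w := fun t => t ^ n * tricomiKernel a b' z t) (p := fun t => -(1 + t) ^ (b - b'))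
    (fun t (ht : 0 < t) => (mul_pos (pow_pos ht _) (tricomiKernel_pos a b' z ht)).le)
    (fun s (hs : 0 < s) t (ht : 0 < t) hst => neg_le_neg
      (Real.rpow_le_rpow (by linarith) (by linarith) (by linarith)))
    (integrableOn_pow_mul_tricomiKernel ha hb' hz n)
    (by simpa only [hmul] using integrableOn_pow_mul_tricomiKernel ha hb' hz (n + 1))
    (hintegrable n) (by simpa only [hmul] using hintegrable (n + 1)) (tricomiMoment_pos ha hb' hz n)
    (by simp only [hmul]; exact tricomiMoment_pos ha hb' hz (n + 1))
  simp only [hmul, hval] at h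
  change _ * tricomiMoment a b' z n ≤ tricomiMoment a b' z (n + 1) * _ at h
  linarith

/-- The zeroth moment is a moment-generating function, hence analytic with explicit derivatives. -/
theorem tricomiMoment_zero_analyticAt_iteratedDeriv {a b z : ℝ} (ha : 0 < a) (hb : b ≤ 0)
    (hz : 0 < z) : AnalyticAt ℝ (fun w => tricomiMoment a b w 0) z ∧
      ∀ n, iteratedDeriv n (fun w => tricomiMoment a b w 0) z =
        (-1) ^ n * tricomiMoment a b z n := by
  let d : ℝ → ENNReal := fun t => ENNReal.ofReal (t ^ (a - 1) * (1 + t) ^ b)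
  let μ : Measure ℝ := (volume.restrict (Ioi 0)).withDensity d
  have hd : Measurable d := by fun_prop
  have hdtop : ∀ᵐ t ∂(volume.restrict (Ioi (0 : ℝ))), d t < ⊤ :=
    Filter.Eventually.of_forall fun t => ENNReal.ofReal_lt_top
  have hdt : ∀ t ∈ Ioi (0 : ℝ), (d t).toReal = t ^ (a - 1) * (1 + t) ^ b := fun t (ht : 0 < t) =>
    ENNReal.toReal_ofReal (by positivity)
  have hval : ∀ (w : ℝ) (n : ℕ), ∫ t, (-t) ^ n * Real.exp (w * -t) ∂μ =
      (-1) ^ n * tricomiMoment a b w n := by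
    intro w n
    rw [integral_withDensity_eq_integral_toReal_smul hd hdtop, tricomiMoment, ← integral_const_mul]
    refine setIntegral_congr_fun measurableSet_Ioi fun t ht => ?_
    simp only [hdt t ht, tricomiKernel, smul_eq_mul, neg_pow t, mul_neg, neg_mul]
    ring
  have hmgf : ProbabilityTheory.mgf (fun t => -t) μ = fun w => tricomiMoment a b w 0 := by
    funext w
    simpa [ProbabilityTheory.mgf] using hval w 0
  have hset : z ∈ interior (ProbabilityTheory.integrableExpSet (fun t => -t) μ) := by
    refine interior_maximal (fun w (hw : 0 < w) => ?_) isOpen_Ioi hz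
    change Integrable _ μ
    rw [integrable_withDensity_iff hd hdtop]
    refine IntegrableOn.congr_fun (integrableOn_pow_mul_tricomiKernel ha hb hw 0) (fun t ht => ?_)
      measurableSet_Ioi
    simp only [hdt t ht, tricomiKernel, pow_zero, one_mul, mul_neg, neg_mul, mul_assoc]
  refine ⟨hmgf ▸ ProbabilityTheory.analyticAt_mgf hset, fun n => ?_⟩
  rw [← hmgf, ProbabilityTheory.iteratedDeriv_mgf hset, hval]

theorem analyticAt_neg_logDeriv_tricomiMoment {a b z : ℝ} (ha : 0 < a) (hb : b ≤ 0) (hz : 0 < z) :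
    AnalyticAt ℝ (fun w => -logDeriv (fun v => tricomiMoment a b v 0) w) z := by
  have h := (tricomiMoment_zero_analyticAt_iteratedDeriv ha hb hz).1
  exact (h.deriv.div h (tricomiMoment_pos ha hb hz 0).ne').neg

/-- The Taylor coefficients of `-L' / L` satisfy the recurrence of a logarithmic derivative. -/
theorem sum_iteratedDeriv_neg_logDeriv {a b z : ℝ} (ha : 0 < a) (hb : b ≤ 0) (hz : 0 < z) (n : ℕ) :
    ∑ j ∈ Finset.range (n + 1),
      ((-1) ^ j * iteratedDeriv j (fun w => -logDeriv (fun v => tricomiMoment a b v 0) w) z /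
        j.factorial) * (tricomiMoment a b z (n - j) / (n - j).factorial) =
      (n + 1) * (tricomiMoment a b z (n + 1) / (n + 1).factorial) := by
  obtain ⟨hL, hder⟩ := tricomiMoment_zero_analyticAt_iteratedDeriv ha hb hz
  have hK := analyticAt_neg_logDeriv_tricomiMoment ha hb hz
  have hprod := iteratedDeriv_fun_mul (n := n) hK.contDiffAt hL.contDiffAt
  have heq : (fun w => -logDeriv (fun v => tricomiMoment a b v 0) w * tricomiMoment a b w 0)
      =ᶠ[nhds z] -deriv fun v => tricomiMoment a b v 0 := by
    filter_upwards [Ioi_mem_nhds hz] with w hw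
    rw [logDeriv_apply, neg_mul, div_mul_cancel₀ _ (tricomiMoment_pos ha hb hw 0).ne']
    rfl
  rw [heq.iteratedDeriv_eq, iteratedDeriv_neg, ← iteratedDeriv_succ', hder] at hprod
  have hfac : ((n + 1).factorial : ℝ) = (n + 1) * n.factorial := by
    push_cast [Nat.factorial_succ]; ring
  have hn0 : (n.factorial : ℝ) ≠ 0 := by positivity
  have hn1 : (n : ℝ) + 1 ≠ 0 := by positivity
  have hright : (n + 1 : ℝ) * (tricomiMoment a b z (n + 1) / (n + 1).factorial) =
      (-1) ^ n * (-((-1) ^ (n + 1) * tricomiMoment a b z (n + 1))) / n.factorial := by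
    rw [hfac, pow_succ]
    field_simp
    rw [← pow_mul, mul_comm n 2, pow_mul]
    simp
  rw [hright, hprod, Finset.mul_sum, Finset.sum_div]
  refine Finset.sum_congr rfl fun j hj => ?_
  have hjn : j ≤ n := Finset.mem_range_succ_iff.mp hj
  rw [hder, Nat.cast_choose ℝ hjn]
  have h1 : (j.factorial : ℝ) ≠ 0 := by positivity
  have h2 : ((n - j).factorial : ℝ) ≠ 0 := by positivity
  have hs : (-1 : ℝ) ^ n * (-1) ^ (n - j) = (-1) ^ j := by
    rw [← pow_add, show n + (n - j) = 2 * (n - j) + j by omega, pow_add, pow_mul]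
    simp
  rw [← hs]
  field_simp

theorem Psi_eq_tricomiMoment (a c z : ℝ) :
    Psi a c z = 1 / Real.Gamma a * tricomiMoment a (c - a - 1) z 0 := by
  simp [Psi, tricomiMoment, tricomiKernel]

/-- Corollary 2: for `a ∈ (0,1]` and `c' < c < 1`, the ratio `z ↦ Ψ(a,c,z)/Ψ(a,c',z)`
is logarithmically completely monotone on `(0,∞)`. -/
theorem Psi_ratio_LCM (a c c' : ℝ) (ha : 0 < a) (ha1 : a ≤ 1) (hcc' : c' < c) (hc : c < 1) :
    ∀ n : ℕ, ∀ z : ℝ, 0 < z →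
      0 ≤ (-1 : ℝ) ^ n *
        iteratedDeriv n
          (fun w => -deriv (fun v => Real.log (Psi a c v / Psi a c' v)) w) z := by
  intro n z hz
  have hb : c - a - 1 ≤ 0 := by linarith
  have hb' : c' - a - 1 ≤ 0 := by linarith
  have hsplit : (fun w => -deriv (fun v => Real.log (Psi a c v / Psi a c' v)) w) =ᶠ[nhds z]
      (fun w => -logDeriv (fun v => tricomiMoment a (c - a - 1) v 0) w) -
        fun w => -logDeriv (fun v => tricomiMoment a (c' - a - 1) v 0) w := by
    filter_upwards [Ioi_mem_nhds hz] with w hw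
    have hlog : (fun v => Real.log (Psi a c v / Psi a c' v)) =ᶠ[nhds w]
        fun v => Real.log (tricomiMoment a (c - a - 1) v 0) -
          Real.log (tricomiMoment a (c' - a - 1) v 0) := by
      filter_upwards [Ioi_mem_nhds hw] with v hv
      rw [Psi_eq_tricomiMoment, Psi_eq_tricomiMoment,
        mul_div_mul_left _ _ (one_div_pos.mpr (Real.Gamma_pos_of_pos ha)).ne',
        Real.log_div (tricomiMoment_pos ha hb hv 0).ne' (tricomiMoment_pos ha hb' hv 0).ne']
    have hd := (tricomiMoment_zero_analyticAt_iteratedDeriv ha hb hw).1.differentiableAt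
    have hd' := (tricomiMoment_zero_analyticAt_iteratedDeriv ha hb' hw).1.differentiableAt
    have hne := (tricomiMoment_pos ha hb hw 0).ne'
    have hne' := (tricomiMoment_pos ha hb' hw 0).ne'
    rw [hlog.deriv_eq, deriv_fun_sub (hd.log hne) (hd'.log hne'), deriv.log hd hne,
      deriv.log hd' hne', Pi.sub_apply, logDeriv_apply, logDeriv_apply]
    ring
  rw [hsplit.iteratedDeriv_eq, iteratedDeriv_sub
    (analyticAt_neg_logDeriv_tricomiMoment ha hb hz).contDiffAt
    (analyticAt_neg_logDeriv_tricomiMoment ha hb' hz).contDiffAt, mul_sub, sub_nonneg]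
  have hpos : ∀ {b : ℝ}, b ≤ 0 → ∀ m : ℕ, 0 < tricomiMoment a b z m / m.factorial := fun hb m =>
    div_pos (tricomiMoment_pos ha hb hz m) (by positivity)
  have hconv : ∀ {b : ℝ}, b ≤ 0 → ∀ m : ℕ,
      tricomiMoment a b z (m + 1) / (m + 1).factorial *
        (tricomiMoment a b z (m + 1) / (m + 1).factorial) ≤
      tricomiMoment a b z m / m.factorial *
        (tricomiMoment a b z (m + 2) / (m + 2).factorial) := by
    intro b hb m
    have h := tricomiMoment_log_convex ha ha1 hb hz m
    push_cast [Nat.factorial_succ]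
    rw [div_mul_div_comm, div_mul_div_comm, div_le_div_iff₀ (by positivity) (by positivity)]
    have hf : 0 ≤ ((m : ℝ) + 1) * m.factorial * m.factorial := by positivity
    have := mul_le_mul_of_nonneg_left h hf
    linarith
  have hle := logDeriv_coeff_le (hpos hb) (hpos hb') (hconv hb) (hconv hb')
    (fun m => by
      rw [div_mul_div_comm, div_mul_div_comm, mul_comm ((m + 1).factorial : ℝ)]
      exact div_le_div_of_nonneg_right (tricomiMoment_mul_le ha hb (by linarith) hz m)
        (by positivity))
    (sum_iteratedDeriv_neg_logDeriv ha hb hz) (sum_iteratedDeriv_neg_logDeriv ha hb' hz) n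
  exact (div_le_div_iff_of_pos_right (by positivity)).mp hle
end

section
/- For every ν > 0, the function z ↦ (H_{−ν}(√z))² / H_{−2ν}(√z) is completely monotone on (0,∞). -/
open MeasureTheory Set

/-- The Hermite function of negative order: `H_{-ν}(z)` for `ν > 0`. -/
noncomputable def HermiteNeg (ν z : ℝ) : ℝ :=
  (1 / Real.Gamma ν) * ∫ t in Ioi (0 : ℝ), Real.exp (-t ^ 2 - 2 * t * z) * t ^ (ν - 1)

/-- `f` is nonnegative on `(0,∞)` together with its alternating differences of order at most `n`. -/
def AltMonotone : ℕ → (ℝ → ℝ) → Prop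
  | 0, f => ∀ z, 0 < z → 0 ≤ f z
  | n + 1, f => (∀ z, 0 < z → 0 ≤ f z) ∧
      ∀ δ, 0 < δ → AltMonotone n (fun z => f z - f (z + δ))

namespace AltMonotone

variable {n : ℕ} {f g : ℝ → ℝ}

theorem nonneg (hf : AltMonotone n f) {z : ℝ} (hz : 0 < z) : 0 ≤ f z := by
  cases n with
  | zero => exact hf z hz
  | succ n => exact hf.1 z hz

theorem of_succ (hf : AltMonotone (n + 1) f) : AltMonotone n f := by
  induction n generalizing f with
  | zero => exact hf.1
  | succ n ih => exact ⟨hf.1, fun δ hδ => ih (hf.2 δ hδ)⟩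

theorem congr (hf : AltMonotone n f) (h : ∀ z, 0 < z → f z = g z) : AltMonotone n g := by
  induction n generalizing f g with
  | zero => exact fun z hz => h z hz ▸ hf z hz
  | succ n ih =>
    refine ⟨fun z hz => h z hz ▸ hf.1 z hz, fun δ hδ => ih (hf.2 δ hδ) fun z hz => ?_⟩
    simp only [h z hz, h (z + δ) (by positivity)]

theorem antitoneOn (hf : AltMonotone (n + 1) f) : AntitoneOn f (Ioi 0) := by
  intro x hx y _ hxy
  rcases hxy.eq_or_lt with rfl | h
  · rfl
  · have := (hf.2 (y - x) (sub_pos.2 h)).nonneg hx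
    simp only [add_sub_cancel] at this
    linarith

theorem const {c : ℝ} (hc : 0 ≤ c) : AltMonotone n (fun _ => c) := by
  induction n generalizing c with
  | zero => exact fun _ _ => hc
  | succ n ih => exact ⟨fun _ _ => hc, fun δ _ => by simpa using ih le_rfl⟩

theorem add (hf : AltMonotone n f) (hg : AltMonotone n g) :
    AltMonotone n (fun z => f z + g z) := by
  induction n generalizing f g with
  | zero => exact fun z hz => add_nonneg (hf z hz) (hg z hz)
  | succ n ih =>
    refine ⟨fun z hz => add_nonneg (hf.1 z hz) (hg.1 z hz), fun δ hδ => ?_⟩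
    exact (ih (hf.2 δ hδ) (hg.2 δ hδ)).congr fun z _ => by ring

theorem comp_add (hf : AltMonotone n f) {c : ℝ} (hc : 0 ≤ c) :
    AltMonotone n (fun z => f (z + c)) := by
  induction n generalizing f with
  | zero => exact fun z hz => hf _ (by positivity)
  | succ n ih =>
    refine ⟨fun z hz => hf.1 _ (by positivity), fun δ hδ => ?_⟩
    exact (ih (hf.2 δ hδ)).congr fun z _ => by ring_nf

theorem comp_mul (hf : AltMonotone n f) {c : ℝ} (hc : 0 < c) :
    AltMonotone n (fun z => f (z * c)) := by
  induction n generalizing f with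
  | zero => exact fun z hz => hf _ (by positivity)
  | succ n ih =>
    refine ⟨fun z hz => hf.1 _ (by positivity), fun δ hδ => ?_⟩
    exact (ih (hf.2 (δ * c) (by positivity))).congr fun z _ => by ring_nf

theorem mul (hf : AltMonotone n f) (hg : AltMonotone n g) :
    AltMonotone n (fun z => f z * g z) := by
  induction n generalizing f g with
  | zero => exact fun z hz => mul_nonneg (hf z hz) (hg z hz)
  | succ n ih =>
    refine ⟨fun z hz => mul_nonneg (hf.1 z hz) (hg.1 z hz), fun δ hδ => ?_⟩
    exact ((ih (hf.2 δ hδ) hg.of_succ).add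
      (ih (hf.of_succ.comp_add hδ.le) (hg.2 δ hδ))).congr fun z _ => by ring

theorem of_tendsto {ι : Type*} {l : Filter ι} [l.NeBot] {F : ι → ℝ → ℝ}
    (hF : ∀ i, AltMonotone n (F i))
    (h : ∀ z, 0 < z → Filter.Tendsto (fun i => F i z) l (nhds (f z))) : AltMonotone n f := by
  induction n generalizing f F with
  | zero => exact fun z hz => ge_of_tendsto' (h z hz) fun i => hF i z hz
  | succ n ih =>
    refine ⟨fun z hz => ge_of_tendsto' (h z hz) fun i => (hF i).1 z hz, fun δ hδ => ?_⟩
    exact ih (fun i => (hF i).2 δ hδ) fun z hz => (h z hz).sub (h (z + δ) (by positivity))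

theorem setIntegral {α : Type*} [MeasurableSpace α] {μ : Measure α} {s : Set α}
    (hs : MeasurableSet s) {F : ℝ → α → ℝ} (hF : ∀ t ∈ s, AltMonotone n (fun z => F z t))
    (hi : ∀ z, 0 < z → IntegrableOn (F z) s μ) :
    AltMonotone n (fun z => ∫ t in s, F z t ∂μ) := by
  induction n generalizing F with
  | zero => exact fun z hz => setIntegral_nonneg hs fun t ht => hF t ht z hz
  | succ n ih =>
    refine ⟨fun z hz => setIntegral_nonneg hs fun t ht => (hF t ht).1 z hz, fun δ hδ => ?_⟩
    refine (ih (fun t ht => (hF t ht).2 δ hδ)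
      fun z hz => (hi z hz).sub (hi (z + δ) (by positivity))).congr fun z hz => ?_
    exact integral_sub (hi z hz) (hi (z + δ) (by positivity))

theorem pow (hf : AltMonotone n f) (k : ℕ) : AltMonotone n (fun z => f z ^ k) := by
  induction k with
  | zero => simpa using const zero_le_one
  | succ k ih => simpa only [pow_succ] using ih.mul hf

theorem sum {ι : Type*} {s : Finset ι} {F : ι → ℝ → ℝ} (hF : ∀ i, AltMonotone n (F i)) :
    AltMonotone n (fun z => ∑ i ∈ s, F i z) := by
  classical
  induction s using Finset.induction_on with
  | empty => simpa using const le_rfl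
  | insert i s hi ih => simpa only [Finset.sum_insert hi] using (hF i).add ih

theorem exp (hf : AltMonotone n f) : AltMonotone n (fun z => Real.exp (f z)) := by
  refine of_tendsto (l := Filter.atTop)
    (F := fun (N : ℕ) z => ∑ k ∈ Finset.range N, f z ^ k * ((k.factorial : ℝ)⁻¹))
    (fun N => sum fun k => (hf.pow k).mul (const (by positivity))) fun z _ => ?_
  have := (NormedSpace.expSeries_div_hasSum_exp (f z)).tendsto_sum_nat
  rw [← Real.exp_eq_exp_ℝ] at this
  simpa only [div_eq_mul_inv] using this

theorem exp_neg_mul {c : ℝ} (hc : 0 ≤ c) : AltMonotone n (fun z => Real.exp (-(z * c))) := by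
  induction n with
  | zero => exact fun z _ => (Real.exp_pos _).le
  | succ n ih =>
    refine ⟨fun z _ => (Real.exp_pos _).le, fun δ hδ => ?_⟩
    have h1 : 0 ≤ 1 - Real.exp (-(δ * c)) := by
      have := Real.exp_le_one_iff.2 (neg_nonpos.2 (mul_nonneg hδ.le hc)); linarith
    refine (ih.mul (const h1)).congr fun z _ => ?_
    simp only [add_mul, neg_add, Real.exp_add]
    ring

/-- A positive function whose negative logarithmic derivative has nonnegative alternating
differences has nonnegative alternating differences. -/
theorem of_hasDerivAt {E : ℝ → ℝ} (hE : ∀ n, AltMonotone n E) (hEc : ContinuousOn E (Ioi 0))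
    (hpos : ∀ z, 0 < z → 0 ≤ f z) (hd : ∀ z, 0 < z → HasDerivAt f (-(E z * f z)) z) :
    AltMonotone n f := by
  induction n with
  | zero => exact hpos
  | succ n ih =>
    refine ⟨hpos, fun δ hδ => ?_⟩
    have hfc : ContinuousOn f (Ioi 0) := fun z hz => (hd z hz).continuousAt.continuousWithinAt
    have hc : ∀ z, 0 < z → ContinuousOn (fun u => E (z + u) * f (z + u)) (Icc 0 δ) := by
      intro z hz
      have hm : MapsTo (fun u => z + u) (Icc 0 δ) (Ioi 0) := fun u hu => by
        have := hu.1; simp only [mem_Ioi]; positivity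
      exact (hEc.comp (by fun_prop) hm).mul (hfc.comp (by fun_prop) hm)
    refine (setIntegral (μ := volume) (s := Ioc 0 δ) measurableSet_Ioc
      (F := fun z u => E (z + u) * f (z + u))
      (fun u hu => ((hE n).mul ih).comp_add hu.1.le) fun z hz =>
        ((hc z hz).integrableOn_Icc).mono_set Ioc_subset_Icc_self).congr fun z hz => ?_
    rw [← intervalIntegral.integral_of_le hδ.le]
    have := intervalIntegral.integral_eq_sub_of_hasDerivAt (a := 0) (b := δ)
      (f := fun u => -f (z + u)) (f' := fun u => E (z + u) * f (z + u)) (fun u hu => ?_) ?_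
    · rw [this, add_zero]; ring
    · rw [uIcc_of_le hδ.le] at hu
      have := (hd (z + u) (by have := hu.1; positivity)).comp_const_add z u
      simpa using this.fun_neg
    · exact ContinuousOn.intervalIntegrable (by rw [uIcc_of_le hδ.le]; exact hc z hz)

theorem iteratedDeriv_nonneg (hf : AltMonotone n f) (hs : ∀ z, 0 < z → ContDiffAt ℝ n f z)
    {z : ℝ} (hz : 0 < z) : 0 ≤ (-1 : ℝ) ^ n * iteratedDeriv n f z := by
  induction n generalizing f z with
  | zero => simpa using hf z hz
  | succ n ih =>
    have hs' : ∀ z, 0 < z → ContDiffAt ℝ n f z := fun z hz =>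
      (hs z hz).of_le (by exact_mod_cast n.le_succ)
    have hanti : AntitoneOn (fun z => (-1 : ℝ) ^ n * iteratedDeriv n f z) (Ioi 0) := by
      intro x hx y _ hxy
      rcases hxy.eq_or_lt with rfl | h
      · rfl
      have hshift : ∀ w, 0 < w → ContDiffAt ℝ n (fun z => f (z + (y - x))) w := fun w hw =>
        ContDiffAt.comp w (hs' (w + (y - x)) (by have := sub_pos.2 h; positivity))
          (contDiffAt_id.add contDiffAt_const)
      have := ih (hf.2 (y - x) (sub_pos.2 h)) (fun w hw => (hs' w hw).sub (hshift w hw)) hx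
      rw [iteratedDeriv_fun_sub (hs' x hx) (hshift x hx), iteratedDeriv_comp_add_const] at this
      simp only [add_sub_cancel] at this
      linarith
    have h1 := hanti.derivWithin_nonpos (x := z)
    rw [derivWithin_of_isOpen isOpen_Ioi hz, deriv_const_mul_field, ← iteratedDeriv_succ] at h1
    rw [pow_succ]
    linarith

end AltMonotone

section LinearODE

variable {D Q S : ℝ → ℝ} {κ z : ℝ}

/-- The primitive of `u ↦ Q (z * u) / u` vanishing at `1`, and its derivative. -/
theorem hasDerivAt_integral_dilation (hQc : ContinuousOn Q (Ioi 0)) (hz : 0 < z) {v : ℝ}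
    (hv : 0 < v) :
    HasDerivAt (fun v => ∫ u in (1 : ℝ)..v, Q (z * u) / u) (Q (z * v) / v) v := by
  have hc : ContinuousOn (fun u => Q (z * u) / u) (Ioi 0) :=
    (hQc.comp (by fun_prop) fun u hu => mul_pos hz hu).div continuousOn_id fun u hu => ne_of_gt hu
  have hsub : uIcc 1 v ⊆ Ioi 0 := fun u hu => lt_of_lt_of_le (lt_min one_pos hv) hu.1
  exact intervalIntegral.integral_hasDerivAt_right (hc.mono hsub).intervalIntegrable
    (hc.stronglyMeasurableAtFilter isOpen_Ioi v hv) (hc.continuousAt (Ioi_mem_nhds hv))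

theorem integral_dilation_le (hQc : ContinuousOn Q (Ioi 0)) (hQ : AntitoneOn Q (Ioi 0))
    (hz : 0 < z) {v : ℝ} (hv : 1 ≤ v) :
    ∫ u in (1 : ℝ)..v, Q (z * u) / u ≤ Q z * Real.log v := by
  have hsub : uIcc 1 v ⊆ Ioi 0 := by
    rw [uIcc_of_le hv]; exact fun u hu => one_pos.trans_le hu.1
  have hc : ContinuousOn (fun u => Q (z * u) / u) (Ioi 0) :=
    (hQc.comp (by fun_prop) fun u hu => mul_pos hz hu).div continuousOn_id fun u hu => ne_of_gt hu
  have hc' : ContinuousOn (fun u => Q z / u) (Ioi 0) :=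
    continuousOn_const.div continuousOn_id fun u hu => ne_of_gt hu
  calc ∫ u in (1 : ℝ)..v, Q (z * u) / u ≤ ∫ u in (1 : ℝ)..v, Q z / u := by
        refine intervalIntegral.integral_mono_on hv (hc.mono hsub).intervalIntegrable
          (hc'.mono hsub).intervalIntegrable fun u hu => ?_
        have hu0 : 0 < u := one_pos.trans_le hu.1
        have := hQ hz (mul_pos hz hu0) (le_mul_of_one_le_right hz.le hu.1)
        gcongr
    _ = Q z * Real.log v := by
        simp only [div_eq_mul_inv, intervalIntegral.integral_const_mul]
        rw [integral_inv_of_pos one_pos (one_pos.trans_le hv), div_one]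

/-- Integral representation of the solutions of `z D' = (z + κ - Q) D - S` that are bounded
at infinity. -/
theorem integral_eq_of_linearODE
    (hD : ∀ z, 0 < z → HasDerivAt D (((z + κ - Q z) * D z - S z) / z) z)
    (hQc : ContinuousOn Q (Ioi 0)) (hQ : AntitoneOn Q (Ioi 0)) (hS : ∀ z, 0 < z → 0 ≤ S z)
    (hb : ∀ z, 0 < z → ∃ C, ∀ y, z ≤ y → |D y| ≤ C) (hz : 0 < z) :
    IntegrableOn (fun v => v ^ (-κ - 1) * Real.exp (-(z * (v - 1))) *
      Real.exp (∫ u in (1 : ℝ)..v, Q (z * u) / u) * S (z * v)) (Ioi 1) ∧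
    ∫ v in Ioi 1, v ^ (-κ - 1) * Real.exp (-(z * (v - 1))) *
      Real.exp (∫ u in (1 : ℝ)..v, Q (z * u) / u) * S (z * v) = D z := by
  set P : ℝ → ℝ := fun v => ∫ u in (1 : ℝ)..v, Q (z * u) / u with hP
  set Φ : ℝ → ℝ := fun v => v ^ (-κ) * Real.exp (-(z * (v - 1))) * Real.exp (P v) * D (z * v)
  set W : ℝ → ℝ := fun v => v ^ (-κ - 1) * Real.exp (-(z * (v - 1))) *
    Real.exp (P v) * S (z * v) with hW
  have hderiv : ∀ v ∈ Ici (1 : ℝ), HasDerivAt Φ (-W v) v := by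
    intro v hv
    have hv0 : 0 < v := one_pos.trans_le hv
    have h1 := Real.hasDerivAt_rpow_const (x := v) (p := -κ) (Or.inl hv0.ne')
    have h2 : HasDerivAt (fun v => Real.exp (-(z * (v - 1))))
        (Real.exp (-(z * (v - 1))) * (-(z * 1))) v :=
      (((hasDerivAt_id v).sub_const 1).const_mul z).fun_neg.exp
    have h3 := (hasDerivAt_integral_dilation hQc hz hv0).exp
    have h4 : HasDerivAt (fun v => D (z * v)) _ v :=
      (hD (z * v) (by positivity)).comp v ((hasDerivAt_id v).const_mul z)
    refine (((h1.mul h2).mul h3).mul h4).congr_deriv ?_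
    have hr : v ^ (-κ) = v ^ (-κ - 1) * v := by
      rw [Real.rpow_sub_one hv0.ne']; field_simp
    simp only [hW, hP, hr, Pi.mul_apply]
    field_simp
    ring
  have hneg : ∀ v ∈ Ioi (1 : ℝ), -W v ≤ 0 := by
    intro v hv
    have hv0 : 0 < v := one_pos.trans hv
    have := hS (z * v) (by positivity)
    simp only [hW, Left.neg_nonpos_iff]
    positivity
  have hlim : Filter.Tendsto Φ Filter.atTop (nhds 0) := by
    obtain ⟨C, hC⟩ := hb z hz
    have ht := (tendsto_rpow_mul_exp_neg_mul_atTop_nhds_zero (Q z - κ) z hz).const_mul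
      (C * Real.exp z)
    rw [mul_zero] at ht
    refine squeeze_zero_norm' ?_ ht
    filter_upwards [Filter.eventually_ge_atTop 1] with v hv
    have hv0 : 0 < v := one_pos.trans_le hv
    have hexp : Real.exp (P v) ≤ v ^ Q z := by
      rw [Real.rpow_def_of_pos hv0, mul_comm]
      exact Real.exp_le_exp.2 (integral_dilation_le hQc hQ hz hv)
    have hDv := hC (z * v) (le_mul_of_one_le_right hz.le hv)
    calc ‖Φ v‖ = v ^ (-κ) * Real.exp (-(z * (v - 1))) * Real.exp (P v) * |D (z * v)| := by
          rw [Real.norm_eq_abs, abs_mul, abs_of_pos (by positivity)]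
      _ ≤ v ^ (-κ) * Real.exp (-(z * (v - 1))) * v ^ Q z * C := by gcongr
      _ = C * Real.exp z * (v ^ (Q z - κ) * Real.exp (-z * v)) := by
          rw [show -(z * (v - 1)) = z + -z * v by ring, Real.exp_add, sub_eq_add_neg (Q z),
            Real.rpow_add hv0]
          ring
  have hint := integrableOn_Ioi_deriv_of_nonpos' hderiv hneg hlim
  refine ⟨by simpa using hint.neg, ?_⟩
  have := integral_Ioi_of_hasDerivAt_of_nonpos' hderiv hneg hlim
  rw [integral_neg] at this
  have h1 : Φ 1 = D z := by simp [Φ, hP]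
  linarith

theorem AltMonotone.of_linearODE
    (hD : ∀ z, 0 < z → HasDerivAt D (((z + κ - Q z) * D z - S z) / z) z)
    (hQc : ContinuousOn Q (Ioi 0)) (hQ : ∀ n, AltMonotone n Q) (hS : ∀ n, AltMonotone n S)
    (hb : ∀ z, 0 < z → ∃ C, ∀ y, z ≤ y → |D y| ≤ C) (n : ℕ) : AltMonotone n D := by
  have hrep := fun z (hz : 0 < z) =>
    integral_eq_of_linearODE hD hQc (hQ 1).antitoneOn (hS 0) hb hz
  refine (AltMonotone.setIntegral measurableSet_Ioi (fun v hv => ?_)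
    fun z hz => (hrep z hz).1).congr fun z hz => (hrep z hz).2
  have hv1 : 1 ≤ v := le_of_lt hv
  have hv0 : 0 < v := one_pos.trans hv
  refine (((AltMonotone.const (by positivity)).mul
    (AltMonotone.exp_neg_mul (sub_nonneg.2 hv1))).mul (AltMonotone.exp ?_)).mul
    ((hS n).comp_mul hv0)
  simp only [intervalIntegral.integral_of_le hv1, div_eq_mul_inv]
  refine AltMonotone.setIntegral measurableSet_Ioc (fun u hu => ?_) fun z hz => ?_
  · have hu0 : 0 < u := one_pos.trans hu.1
    exact ((hQ n).comp_mul hu0).mul (AltMonotone.const (by positivity))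
  · refine (ContinuousOn.integrableOn_Icc ?_).mono_set Ioc_subset_Icc_self
    have hm : ∀ u ∈ Icc 1 v, 0 < u := fun u hu => one_pos.trans_le hu.1
    exact (hQc.comp (by fun_prop) fun u hu => mul_pos hz (hm u hu)).mul
      (continuousOn_id.inv₀ fun u hu => (hm u hu).ne')

end LinearODE

section RiccatiODE

variable {R : ℝ → ℝ} {a κ c : ℝ}

/-- A solution of `z R' = (z + κ) R - a R² - c` with values in `[0,1]` is the uniform limit of the
Picard iterates of the corresponding integral equation, which preserves alternating
monotonicity. -/
theorem AltMonotone.of_riccatiODE (ha : 0 ≤ a) (hc : 0 ≤ c) (hκ : 2 * a < κ) (hac : a + c ≤ κ)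
    (hR : ∀ z, 0 < z → HasDerivAt R (((z + κ) * R z - (a * R z ^ 2 + c)) / z) z)
    (h0 : ∀ z, 0 < z → 0 ≤ R z) (h1 : ∀ z, 0 < z → R z ≤ 1) (n : ℕ) : AltMonotone n R := by
  have hκ0 : 0 < κ := by linarith
  let w : ℝ → ℝ → ℝ := fun z v => v ^ (-κ - 1) * Real.exp (-(z * (v - 1)))
  let T : (ℝ → ℝ) → ℝ → ℝ := fun h z => ∫ v in Ioi 1, w z v * (a * h (z * v) ^ 2 + c)
  have hp : IntegrableOn (fun v : ℝ => v ^ (-κ - 1)) (Ioi 1) :=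
    integrableOn_Ioi_rpow_of_lt (by linarith) one_pos
  have hpi : ∫ v in Ioi (1 : ℝ), v ^ (-κ - 1) = 1 / κ := by
    rw [integral_Ioi_rpow_of_lt (by linarith) one_pos]
    simp [neg_div]
  have hw0 : ∀ z, ∀ v ∈ Ioi (1 : ℝ), 0 ≤ w z v := fun z v hv => by
    have : (0 : ℝ) < v := one_pos.trans hv
    positivity
  have hw1 : ∀ z, 0 < z → ∀ v ∈ Ioi (1 : ℝ), w z v ≤ v ^ (-κ - 1) := fun z hz v hv => by
    have hv0 : (0 : ℝ) < v := one_pos.trans hv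
    refine mul_le_of_le_one_right (by positivity) (Real.exp_le_one_iff.2 ?_)
    have := mul_pos hz (sub_pos.2 hv)
    linarith
  have hwm : ∀ z, AEStronglyMeasurable (w z) (volume.restrict (Ioi 1)) := fun z => by
    refine Measurable.aestronglyMeasurable ?_
    fun_prop
  have hRT : ∀ z, 0 < z → IntegrableOn (fun v => w z v * (a * R (z * v) ^ 2 + c)) (Ioi 1) ∧
      T R z = R z := fun z hz => by
    have := integral_eq_of_linearODE (D := R) (Q := fun _ => 0)
      (S := fun z => a * R z ^ 2 + c) (κ := κ) (by simpa using hR) continuousOn_const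
      (fun _ _ _ _ _ => le_rfl) (fun z _ => by positivity)
      (fun z hz => ⟨1, fun y hy => abs_le.2
        ⟨by linarith [h0 y (hz.trans_le hy)], h1 y (hz.trans_le hy)⟩⟩) hz
    simpa [w, T] using this
  have hTint : ∀ h : ℝ → ℝ, AntitoneOn h (Ioi 0) → (∀ z, 0 < z → 0 ≤ h z) →
      (∀ z, 0 < z → h z ≤ 1) → ∀ z, 0 < z →
      IntegrableOn (fun v => w z v * (a * h (z * v) ^ 2 + c)) (Ioi 1) := by
    intro h hanti hh0 hh1 z hz
    have hm : AEMeasurable (fun v => h (z * v)) (volume.restrict (Ioi 1)) :=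
      aemeasurable_restrict_of_antitoneOn measurableSet_Ioi fun x hx y hy hxy =>
        hanti (mul_pos hz (one_pos.trans hx)) (mul_pos hz (one_pos.trans hy)) (by gcongr)
    refine Integrable.mono' (hp.const_mul κ)
      ((hwm z).mul (((hm.pow_const 2).const_mul a).add_const c).aestronglyMeasurable) ?_
    filter_upwards [ae_restrict_mem measurableSet_Ioi] with v hv
    have hv0 : (0 : ℝ) < v := one_pos.trans hv
    have e0 := hh0 (z * v) (by positivity)
    have e1 := hh1 (z * v) (by positivity)
    have e2 : h (z * v) ^ 2 ≤ 1 := pow_le_one₀ e0 e1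
    have e3 : a * h (z * v) ^ 2 + c ≤ κ := by nlinarith
    rw [Real.norm_of_nonneg (mul_nonneg (hw0 z v hv) (by positivity)), mul_comm κ]
    exact mul_le_mul (hw1 z hz v hv) e3 (by positivity) (by positivity)
  have hiter : ∀ j : ℕ, (∀ n, AltMonotone n (T^[j] 0)) ∧ (∀ z, 0 < z → T^[j] 0 z ≤ 1) ∧
      ∀ z, 0 < z → |R z - T^[j] 0 z| ≤ (2 * a / κ) ^ j := by
    intro j
    induction j with
    | zero =>
      refine ⟨fun n => AltMonotone.const le_rfl, fun z _ => by simp, fun z hz => ?_⟩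
      simpa [abs_of_nonneg (h0 z hz)] using h1 z hz
    | succ j ih =>
      obtain ⟨hmono, hle, hdist⟩ := ih
      rw [Function.iterate_succ_apply']
      set h := T^[j] 0
      have hint := hTint h (hmono 1).antitoneOn (hmono 0) hle
      refine ⟨fun n => ?_, fun z hz => ?_, fun z hz => ?_⟩
      · refine AltMonotone.setIntegral measurableSet_Ioi (fun v hv => ?_) hint
        have hv0 : (0 : ℝ) < v := one_pos.trans hv
        exact ((AltMonotone.const (by positivity)).mul
          (AltMonotone.exp_neg_mul (sub_nonneg.2 (le_of_lt hv)))).mul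
          (((AltMonotone.const ha).mul (((hmono n).comp_mul hv0).pow 2)).add
            (AltMonotone.const hc))
      · calc T h z ≤ ∫ v in Ioi (1 : ℝ), v ^ (-κ - 1) * κ := by
              refine setIntegral_mono_on (hint z hz) (hp.mul_const κ) measurableSet_Ioi
                fun v hv => ?_
              have hv0 : (0 : ℝ) < v := one_pos.trans hv
              have e0 := hmono 0 (z * v) (by positivity)
              have e1 := hle (z * v) (by positivity)
              have e2 : h (z * v) ^ 2 ≤ 1 := pow_le_one₀ e0 e1
              exact mul_le_mul (hw1 z hz v hv) (by nlinarith) (by positivity) (by positivity)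
          _ = 1 := by rw [integral_mul_const, hpi]; field_simp
      · rw [← (hRT z hz).2, ← integral_sub (hRT z hz).1 (hint z hz), ← Real.norm_eq_abs]
        refine (norm_integral_le_of_norm_le
          (hp.mul_const (2 * a * (2 * a / κ) ^ j)) ?_).trans_eq ?_
        · filter_upwards [ae_restrict_mem measurableSet_Ioi] with v hv
          have hv0 : (0 : ℝ) < v := one_pos.trans hv
          have hzv : 0 < z * v := by positivity
          rw [← mul_sub, norm_mul, Real.norm_of_nonneg (hw0 z v hv)]
          refine mul_le_mul (hw1 z hz v hv) ?_ (norm_nonneg _) (by positivity)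
          rw [show a * R (z * v) ^ 2 + c - (a * h (z * v) ^ 2 + c) =
            a * (R (z * v) + h (z * v)) * (R (z * v) - h (z * v)) by ring, norm_mul,
            Real.norm_eq_abs (_ - _)]
          have e0 := hmono 0 (z * v) hzv
          have e1 := hle (z * v) hzv
          have e2 := h0 (z * v) hzv
          have e3 := h1 (z * v) hzv
          refine mul_le_mul ?_ (hdist _ hzv) (abs_nonneg _) (by positivity)
          rw [Real.norm_of_nonneg (by positivity)]
          nlinarith
        · rw [integral_mul_const, hpi, pow_succ]
          field_simp
  refine AltMonotone.of_tendsto (l := Filter.atTop) (fun j => (hiter j).1 n) fun z hz => ?_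
  have hθ : 2 * a / κ < 1 := (div_lt_one hκ0).2 hκ
  rw [tendsto_iff_norm_sub_tendsto_zero]
  refine squeeze_zero (fun _ => norm_nonneg _) (fun j => ?_)
    (tendsto_pow_atTop_nhds_zero_of_lt_one (by positivity) hθ)
  rw [norm_sub_rev]
  exact (hiter j).2.2 z hz

end RiccatiODE

section Hermite

variable {ν x : ℝ}

theorem exp_neg_sq_sub_le {M t : ℝ} (hx : |x| ≤ M) (ht : 0 ≤ t) :
    Real.exp (-t ^ 2 - 2 * t * x) ≤ Real.exp (2 * M ^ 2) * Real.exp (-(1 / 2) * t ^ 2) := by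
  rw [← Real.exp_add]
  refine Real.exp_le_exp.2 ?_
  have h1 : t * (-x) ≤ t * M := mul_le_mul_of_nonneg_left ((neg_le_abs x).trans hx) ht
  nlinarith [sq_nonneg (t - 2 * M)]

theorem integrableOn_hermiteNeg (hν : 0 < ν) (x : ℝ) :
    IntegrableOn (fun t : ℝ => Real.exp (-t ^ 2 - 2 * t * x) * t ^ (ν - 1)) (Ioi 0) := by
  refine Integrable.mono' ((integrableOn_rpow_mul_exp_neg_mul_sq (b := 1 / 2) (s := ν - 1)
    (by norm_num) (by linarith)).const_mul (Real.exp (2 * |x| ^ 2))) ?_ ?_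
  · exact Measurable.aestronglyMeasurable (by fun_prop)
  · filter_upwards [ae_restrict_mem measurableSet_Ioi] with t ht
    have ht0 : (0 : ℝ) < t := ht
    rw [Real.norm_of_nonneg (by positivity), mul_comm (t ^ (ν - 1)), ← mul_assoc]
    gcongr
    exact exp_neg_sq_sub_le le_rfl ht0.le

theorem hermiteNeg_pos (hν : 0 < ν) (x : ℝ) : 0 < HermiteNeg ν x := by
  refine mul_pos (one_div_pos.2 (Real.Gamma_pos_of_pos hν)) ?_
  rw [setIntegral_pos_iff_support_of_nonneg_ae _ (integrableOn_hermiteNeg hν x)]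
  · have : Function.support (fun t : ℝ => Real.exp (-t ^ 2 - 2 * t * x) * t ^ (ν - 1)) ∩ Ioi 0
        = Ioi 0 := by
      refine inter_eq_right.2 fun t ht => ?_
      have ht0 : (0 : ℝ) < t := ht
      exact (by positivity : (0 : ℝ) < _).ne'
    rw [this]
    simp
  · filter_upwards [ae_restrict_mem measurableSet_Ioi] with t ht
    have ht0 : (0 : ℝ) < t := ht
    simp only [Pi.zero_apply]
    positivity

theorem hasDerivAt_hermiteNeg (hν : 0 < ν) (x : ℝ) :
    HasDerivAt (HermiteNeg ν) (-2 * ν * HermiteNeg (ν + 1) x) x := by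
  have hmain := (hasDerivAt_integral_of_dominated_loc_of_deriv_le
    (μ := volume.restrict (Ioi (0 : ℝ))) (s := Metric.ball x 1) (x₀ := x)
    (F := fun y t => Real.exp (-t ^ 2 - 2 * t * y) * t ^ (ν - 1))
    (F' := fun y t => -2 * (Real.exp (-t ^ 2 - 2 * t * y) * t ^ (ν + 1 - 1)))
    (bound := fun t => 2 * (Real.exp (2 * (|x| + 1) ^ 2) *
      (t ^ (ν + 1 - 1) * Real.exp (-(1 / 2) * t ^ 2))))
    (Metric.ball_mem_nhds x one_pos)
    (Filter.Eventually.of_forall fun y => (integrableOn_hermiteNeg hν y).aestronglyMeasurable)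
    (integrableOn_hermiteNeg hν x)
    ((integrableOn_hermiteNeg (by linarith : 0 < ν + 1) x).const_mul _).aestronglyMeasurable
    ?_ ?_ ?_).2
  · have hG : Real.Gamma (ν + 1) = ν * Real.Gamma ν := Real.Gamma_add_one hν.ne'
    have hG0 := (Real.Gamma_pos_of_pos hν).ne'
    refine (hmain.const_mul (1 / Real.Gamma ν)).congr_deriv ?_
    simp only [HermiteNeg, hG, integral_const_mul]
    field_simp
  · filter_upwards [ae_restrict_mem measurableSet_Ioi] with t ht y hy
    have ht0 : (0 : ℝ) < t := ht
    have hyx : |y| ≤ |x| + 1 := by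
      have h1 : |y - x| < 1 := by simpa [Real.dist_eq] using hy
      have h2 := abs_sub_abs_le_abs_sub y x
      linarith
    rw [norm_mul, Real.norm_of_nonneg (by positivity : 0 ≤ Real.exp _ * _)]
    norm_num
    rw [mul_comm (t ^ ν), ← mul_assoc (Real.exp (2 * _))]
    gcongr
    simpa using exp_neg_sq_sub_le hyx ht0.le
  · exact ((integrableOn_rpow_mul_exp_neg_mul_sq (by norm_num) (by linarith)).const_mul
      _).const_mul _
  · filter_upwards [ae_restrict_mem measurableSet_Ioi] with t ht y _
    have ht0 : (0 : ℝ) < t := ht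
    have h1 : HasDerivAt (fun y => -t ^ 2 - 2 * t * y) (-(2 * t * 1)) y :=
      ((hasDerivAt_id y).const_mul (2 * t)).const_sub _
    refine (h1.exp.mul_const (t ^ (ν - 1))).congr_deriv ?_
    rw [add_sub_right_comm, Real.rpow_add_one ht0.ne']
    ring

theorem hermiteNeg_recurrence (hν : 0 < ν) (x : ℝ) :
    2 * x * HermiteNeg (ν + 1) x + 2 * (ν + 1) * HermiteNeg (ν + 2) x = HermiteNeg ν x := by
  let e : ℝ → ℝ := fun t => Real.exp (-t ^ 2 - 2 * t * x)
  have hI : ∀ {μ : ℝ}, 0 < μ → IntegrableOn (fun t : ℝ => e t * t ^ (μ - 1)) (Ioi 0) :=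
    fun hμ => integrableOn_hermiteNeg hμ x
  have h0 := (hI hν).const_mul ν
  have h1 := (hI (by linarith : 0 < ν + 1)).const_mul (2 * x)
  have h2 := (hI (by linarith : 0 < ν + 2)).const_mul 2
  have hderiv : ∀ t ∈ Ioi (0 : ℝ), HasDerivAt (fun t => e t * t ^ ν)
      (ν * (e t * t ^ (ν - 1)) - (2 * x * (e t * t ^ (ν + 1 - 1)) +
        2 * (e t * t ^ (ν + 2 - 1)))) t := by
    intro t ht
    have ht0 : (0 : ℝ) < t := ht
    have hd : HasDerivAt (fun t => -t ^ 2 - 2 * t * x) (-(2 * t) - 2 * x) t := by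
      have := ((hasDerivAt_pow 2 t).fun_neg).fun_sub (((hasDerivAt_id t).const_mul 2).mul_const x)
      simpa using this
    refine (hd.exp.mul (Real.hasDerivAt_rpow_const (p := ν) (Or.inl ht0.ne'))).congr_deriv ?_
    rw [show ν + 2 - 1 = ν + 1 by ring, Real.rpow_add_one ht0.ne', add_sub_cancel_right]
    simp only [e]
    ring
  have hlim : Filter.Tendsto (fun t => e t * t ^ ν) Filter.atTop (nhds 0) := by
    refine squeeze_zero' ?_ ?_ ((tendsto_rpow_mul_exp_neg_mul_atTop_nhds_zero ν 1
      one_pos).const_mul (Real.exp ((1 / 2 - x) ^ 2)) |>.trans (by rw [mul_zero]))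
    · filter_upwards [Filter.eventually_ge_atTop 0] with t ht
      positivity
    · filter_upwards [Filter.eventually_ge_atTop 0] with t ht
      have : e t ≤ Real.exp ((1 / 2 - x) ^ 2) * Real.exp (-1 * t) := by
        rw [← Real.exp_add]
        refine Real.exp_le_exp.2 ?_
        nlinarith [sq_nonneg (t - (1 / 2 - x))]
      calc e t * t ^ ν ≤ Real.exp ((1 / 2 - x) ^ 2) * Real.exp (-1 * t) * t ^ ν := by gcongr
        _ = _ := by ring
  have hcont : ContinuousWithinAt (fun t => e t * t ^ ν) (Ici 0) 0 := by
    refine ContinuousAt.continuousWithinAt (ContinuousAt.mul ?_ ?_)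
    · fun_prop
    · exact Real.continuousAt_rpow_const 0 ν (Or.inr hν.le)
  have h12 : IntegrableOn (fun t : ℝ => 2 * x * (e t * t ^ (ν + 1 - 1)) +
      2 * (e t * t ^ (ν + 2 - 1))) (Ioi 0) := h1.add h2
  have hint := integral_Ioi_of_hasDerivAt_of_tendsto hcont hderiv (h0.sub h12) hlim
  rw [integral_sub h0 h12, integral_add h1 h2] at hint
  simp only [integral_const_mul, Real.zero_rpow hν.ne', mul_zero, sub_zero] at hint
  have hG : Real.Gamma (ν + 1) = ν * Real.Gamma ν := Real.Gamma_add_one hν.ne'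
  have hG2 : Real.Gamma (ν + 2) = (ν + 1) * (ν * Real.Gamma ν) := by
    rw [← hG, ← Real.Gamma_add_one (by linarith)]; ring_nf
  have hG0 := (Real.Gamma_pos_of_pos hν).ne'
  have hν1 : ν + 1 ≠ 0 := by linarith
  have hH : ∀ μ, HermiteNeg μ x = 1 / Real.Gamma μ * ∫ t in Ioi 0, e t * t ^ (μ - 1) :=
    fun _ => rfl
  rw [hH, hH, hH, hG, hG2]
  field_simp
  linarith

theorem contDiff_hermiteNeg (n : ℕ) (hν : 0 < ν) : ContDiff ℝ n (HermiteNeg ν) := by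
  induction n generalizing ν with
  | zero =>
    exact contDiff_zero.2 (continuous_iff_continuousAt.2 fun x =>
      (hasDerivAt_hermiteNeg hν x).continuousAt)
  | succ n ih =>
    have hd : deriv (HermiteNeg ν) = fun x => -2 * ν * HermiteNeg (ν + 1) x :=
      funext fun x => (hasDerivAt_hermiteNeg hν x).deriv
    push_cast
    refine contDiff_succ_iff_deriv.2
      ⟨fun x => (hasDerivAt_hermiteNeg hν x).differentiableAt, by simp, ?_⟩
    rw [hd]
    exact contDiff_const.mul (ih (by linarith))

/-- The normalized ratio `2 H_{-ν-1}(√z) / (√z H_{-ν}(√z))`. -/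
noncomputable def hermiteQuot (ν z : ℝ) : ℝ :=
  2 * HermiteNeg (ν + 1) (Real.sqrt z) / (Real.sqrt z * HermiteNeg ν (Real.sqrt z))

variable {z : ℝ}

theorem hermiteQuot_pos (hν : 0 < ν) (hz : 0 < z) : 0 < hermiteQuot ν z := by
  have h0 := hermiteNeg_pos hν (Real.sqrt z)
  have h1 := hermiteNeg_pos (by linarith : 0 < ν + 1) (Real.sqrt z)
  have := Real.sqrt_pos.2 hz
  unfold hermiteQuot
  positivity

theorem mul_hermiteQuot_mul (hν : 0 < ν) (hz : 0 < z) :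
    z * hermiteQuot ν z * (1 + (ν + 1) / 2 * hermiteQuot (ν + 1) z) = 1 := by
  have h0 := hermiteNeg_pos hν (Real.sqrt z)
  have h1 := hermiteNeg_pos (by linarith : 0 < ν + 1) (Real.sqrt z)
  have hr := hermiteNeg_recurrence hν (Real.sqrt z)
  have hs := Real.sqrt_pos.2 hz
  have hzs : z = Real.sqrt z ^ 2 := (Real.sq_sqrt hz.le).symm
  unfold hermiteQuot
  rw [show ν + 1 + 1 = ν + 2 by ring]
  generalize Real.sqrt z = s at *
  subst hzs
  field_simp
  linarith

theorem mul_hermiteQuot_le_one (hν : 0 < ν) (hz : 0 < z) : z * hermiteQuot ν z ≤ 1 := by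
  have h := mul_hermiteQuot_mul hν hz
  have h0 := mul_pos hz (hermiteQuot_pos hν hz)
  have h1 := hermiteQuot_pos (by linarith : 0 < ν + 1) hz
  have : 0 < z * hermiteQuot ν z * ((ν + 1) / 2 * hermiteQuot (ν + 1) z) := by positivity
  linarith

theorem hasDerivAt_hermiteNeg_sqrt (hν : 0 < ν) (hz : 0 < z) :
    HasDerivAt (fun z => HermiteNeg ν (Real.sqrt z))
      (-(ν * HermiteNeg (ν + 1) (Real.sqrt z) / Real.sqrt z)) z := by
  have := (hasDerivAt_hermiteNeg hν (Real.sqrt z)).comp z (Real.hasDerivAt_sqrt hz.ne')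
  refine this.congr_deriv ?_
  have hs := Real.sqrt_pos.2 hz
  field_simp

/-- The Riccati equation satisfied by `hermiteQuot ν`. -/
theorem hasDerivAt_hermiteQuot (hν : 0 < ν) (hz : 0 < z) :
    HasDerivAt (hermiteQuot ν) (ν / 2 * hermiteQuot ν z ^ 2 + hermiteQuot ν z
      - hermiteQuot ν z / (2 * z) - 1 / z) z := by
  have hν1 : 0 < ν + 1 := by linarith
  have h0 := hermiteNeg_pos hν (Real.sqrt z)
  have hs := Real.sqrt_pos.2 hz
  have hr := hermiteNeg_recurrence hν (Real.sqrt z)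
  have hd := ((hasDerivAt_hermiteNeg_sqrt hν1 hz).const_mul 2).div
    ((Real.hasDerivAt_sqrt hz.ne').mul (hasDerivAt_hermiteNeg_sqrt hν hz))
    (mul_pos hs h0).ne'
  refine hd.congr_deriv ?_
  have hzs : z = Real.sqrt z ^ 2 := (Real.sq_sqrt hz.le).symm
  unfold hermiteQuot
  rw [show ν + 1 + 1 = ν + 2 by ring]
  simp only [Pi.mul_apply]
  have hr' : HermiteNeg (ν + 2) (Real.sqrt z) = (HermiteNeg ν (Real.sqrt z) -
      2 * Real.sqrt z * HermiteNeg (ν + 1) (Real.sqrt z)) / (2 * (ν + 1)) := by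
    field_simp
    linarith
  rw [hr']
  generalize Real.sqrt z = s at *
  subst hzs
  field_simp
  ring

theorem continuousOn_hermiteQuot (hν : 0 < ν) : ContinuousOn (hermiteQuot ν) (Ioi 0) :=
  fun _ hz => (hasDerivAt_hermiteQuot hν hz).continuousAt.continuousWithinAt

theorem altMonotone_one_sub_mul_hermiteQuot (hν : 0 < ν) (n : ℕ) :
    AltMonotone n (fun z => 1 - z * hermiteQuot ν z) := by
  refine AltMonotone.of_riccatiODE (a := ν / 2) (κ := 1 / 2 + ν) (c := (ν + 1) / 2)
    (by positivity) (by positivity) (by linarith) (by linarith) (fun z hz => ?_)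
    (fun z hz => sub_nonneg.2 (mul_hermiteQuot_le_one hν hz))
    (fun z hz => by linarith [mul_pos hz (hermiteQuot_pos hν hz)]) n
  refine (((hasDerivAt_id z).mul (hasDerivAt_hermiteQuot hν hz)).const_sub 1).congr_deriv ?_
  simp only [id]
  field_simp
  ring

theorem abs_hermiteQuot_le (hν : 0 < ν) {y : ℝ} (hz : 0 < z) (hy : z ≤ y) :
    |hermiteQuot ν y| ≤ 1 / z := by
  have hy0 : 0 < y := hz.trans_le hy
  have hp := hermiteQuot_pos hν hy0
  rw [abs_of_pos hp, le_div_iff₀ hz]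
  nlinarith [mul_hermiteQuot_le_one hν hy0]

theorem abs_mul_hermiteQuot_sub_le {ν μ : ℝ} (hν : 0 < ν) (hμ : 0 < μ) {p q y : ℝ} (hz : 0 < z)
    (hy : z ≤ y) : |p * hermiteQuot ν y - q * hermiteQuot μ y| ≤ |p| * (1 / z) + |q| * (1 / z) := by
  refine (abs_sub _ _).trans ?_
  rw [abs_mul, abs_mul]
  gcongr
  · exact abs_hermiteQuot_le hν hz hy
  · exact abs_hermiteQuot_le hμ hz hy

theorem continuousOn_one_sub_mul_hermiteQuot (hν : 0 < ν) :
    ContinuousOn (fun z => 1 - z * hermiteQuot ν z) (Ioi 0) :=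
  continuousOn_const.sub (continuousOn_id.mul (continuousOn_hermiteQuot hν))

/-- The logarithmic derivatives of `z ↦ H_{-ν}(√z)` are ordered in `ν`. -/
theorem altMonotone_mul_hermiteQuot_sub {ν μ : ℝ} (hν : 0 < ν) (hνμ : ν ≤ μ) (n : ℕ) :
    AltMonotone n (fun z => μ / 2 * hermiteQuot μ z - ν / 2 * hermiteQuot ν z) := by
  have hμ : 0 < μ := hν.trans_le hνμ
  refine AltMonotone.of_linearODE (κ := (ν + μ - 1) / 2)
    (Q := fun z => ν / 2 * (1 - z * hermiteQuot ν z) + μ / 2 * (1 - z * hermiteQuot μ z))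
    (S := fun _ => (μ - ν) / 2) (fun z hz => ?_) ?_ (fun n => ?_)
    (fun n => AltMonotone.const (by linarith))
    (fun z hz => ⟨_, fun y hy => abs_mul_hermiteQuot_sub_le hμ hν hz hy⟩) n
  · refine (((hasDerivAt_hermiteQuot hμ hz).const_mul (μ / 2)).fun_sub
      ((hasDerivAt_hermiteQuot hν hz).const_mul (ν / 2))).congr_deriv ?_
    field_simp
    ring
  · exact (continuousOn_const.mul (continuousOn_one_sub_mul_hermiteQuot hν)).add
      (continuousOn_const.mul (continuousOn_one_sub_mul_hermiteQuot hμ))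
  · exact ((AltMonotone.const (by linarith)).mul (altMonotone_one_sub_mul_hermiteQuot hν n)).add
      ((AltMonotone.const (by linarith)).mul (altMonotone_one_sub_mul_hermiteQuot hμ n))

theorem altMonotone_mul_hermiteQuot_sq (hν : 0 < ν) (n : ℕ) :
    AltMonotone n (fun z => z * hermiteQuot ν z ^ 2) := by
  have hν1 : 0 < ν + 1 := by linarith
  refine AltMonotone.of_hasDerivAt
    (E := fun z => 2 * ((ν + 1) / 2 * hermiteQuot (ν + 1) z - ν / 2 * hermiteQuot ν z))
    (fun n => (AltMonotone.const zero_le_two).mul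
      (altMonotone_mul_hermiteQuot_sub hν (by linarith) n)) ?_ (fun z hz => by positivity)
    fun z hz => ?_
  · exact continuousOn_const.mul ((continuousOn_const.mul (continuousOn_hermiteQuot hν1)).sub
      (continuousOn_const.mul (continuousOn_hermiteQuot hν)))
  · refine ((hasDerivAt_id z).mul ((hasDerivAt_hermiteQuot hν hz).pow 2)).congr_deriv ?_
    have h := mul_hermiteQuot_mul hν hz
    have h0 := hermiteQuot_pos hν hz
    have hr : hermiteQuot (ν + 1) z =
        (1 - z * hermiteQuot ν z) / (z * hermiteQuot ν z * ((ν + 1) / 2)) := by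
      field_simp
      linarith
    simp only [hr, id, Pi.pow_apply]
    field_simp
    ring

theorem altMonotone_hermiteQuot_sub {ν μ : ℝ} (hν : 0 < ν) (hνμ : ν ≤ μ) (n : ℕ) :
    AltMonotone n (fun z => hermiteQuot ν z - hermiteQuot μ z) := by
  have hμ : 0 < μ := hν.trans_le hνμ
  refine AltMonotone.of_linearODE (κ := μ - 1 / 2)
    (Q := fun z => μ / 2 * ((1 - z * hermiteQuot ν z) + (1 - z * hermiteQuot μ z)))
    (S := fun z => (μ - ν) / 2 * (z * hermiteQuot ν z ^ 2)) (fun z hz => ?_) ?_ (fun n => ?_)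
    (fun n => (AltMonotone.const (by linarith)).mul (altMonotone_mul_hermiteQuot_sq hν n))
    (fun z hz => ⟨_, fun y hy => by
      simpa using abs_mul_hermiteQuot_sub_le (p := 1) (q := 1) hν hμ hz hy⟩) n
  · refine ((hasDerivAt_hermiteQuot hν hz).fun_sub
      (hasDerivAt_hermiteQuot hμ hz)).congr_deriv ?_
    field_simp
    ring
  · exact continuousOn_const.mul ((continuousOn_one_sub_mul_hermiteQuot hν).add
      (continuousOn_one_sub_mul_hermiteQuot hμ))
  · exact (AltMonotone.const (by linarith)).mul
      ((altMonotone_one_sub_mul_hermiteQuot hν n).add (altMonotone_one_sub_mul_hermiteQuot hμ n))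

theorem altMonotone_hermiteNeg_sq_div (hν : 0 < ν) (n : ℕ) :
    AltMonotone n
      (fun w => (HermiteNeg ν (Real.sqrt w)) ^ 2 / HermiteNeg (2 * ν) (Real.sqrt w)) := by
  have h2ν : 0 < 2 * ν := by linarith
  refine AltMonotone.of_hasDerivAt
    (E := fun z => ν * (hermiteQuot ν z - hermiteQuot (2 * ν) z))
    (fun n => (AltMonotone.const hν.le).mul (altMonotone_hermiteQuot_sub hν (by linarith) n))
    (continuousOn_const.mul ((continuousOn_hermiteQuot hν).sub (continuousOn_hermiteQuot h2ν)))
    (fun z _ => div_nonneg (sq_nonneg _) (hermiteNeg_pos h2ν _).le) fun z hz => ?_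
  have h0 := hermiteNeg_pos hν (Real.sqrt z)
  have h1 := hermiteNeg_pos h2ν (Real.sqrt z)
  have hs := Real.sqrt_pos.2 hz
  refine (((hasDerivAt_hermiteNeg_sqrt hν hz).pow 2).div
    (hasDerivAt_hermiteNeg_sqrt h2ν hz) h1.ne').congr_deriv ?_
  simp only [hermiteQuot, Pi.pow_apply]
  generalize HermiteNeg (2 * ν) (Real.sqrt z) = k at *
  field_simp
  ring

end Hermite

/-- Corollary: for every `ν > 0`, `z ↦ (H_{-ν}(√z))² / H_{-2ν}(√z)` is completely
monotone on `(0,∞)`. -/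
theorem Hermite_ratio_CM (ν : ℝ) (hν : 0 < ν) :
    ∀ n : ℕ, ∀ z : ℝ, 0 < z →
      0 ≤ (-1 : ℝ) ^ n *
        iteratedDeriv n
          (fun w => (HermiteNeg ν (Real.sqrt w)) ^ 2 / HermiteNeg (2 * ν) (Real.sqrt w)) z := by
  intro n z hz
  refine (altMonotone_hermiteNeg_sq_div hν n).iteratedDeriv_nonneg (fun w hw => ?_) hz
  have h2ν : 0 < 2 * ν := by linarith
  have hsqrt : ContDiffAt ℝ n Real.sqrt w := Real.contDiffAt_sqrt hw.ne'
  exact (((contDiff_hermiteNeg n hν).contDiffAt.comp w hsqrt).pow 2).div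
    ((contDiff_hermiteNeg n h2ν).contDiffAt.comp w hsqrt) (hermiteNeg_pos h2ν _).ne'
end
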